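/- arXiv:math/0406024 — 4 statements merged into one kernel-verified Lean document; each statement's English description precedes it below -/
import Mathlib

section
/- If a connected graph G has diameter 2, then f(G) ≤ n(G) + 1. -/
/-- A single pebbling step: remove two pebbles from `u` and place one on an adjacent `v`. -/
def PebStep {V : Type*} [DecidableEq V] (G : SimpleGraph V) (D D' : V → ℕ) : Prop :=
  ∃ u v : V, G.Adj u v ∧ 2 ≤ D u ∧
    D' = Function.update (Function.update D u (D u - 2)) v (D v + 1)

/-- `D` is `r`-solvable: some sequence of pebbling steps places a pebble on `r`. -/
def PebSolvable {V : Type*} [DecidableEq V] (G : SimpleGraph V) (D : V → ℕ) (r : V) : Prop :=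
  ∃ D' : V → ℕ, Relation.ReflTransGen (PebStep G) D D' ∧ 1 ≤ D' r

/-- The pebbling number of `G`: the least `t` such that every distribution of size `t`
is `r`-solvable for every root `r`. -/
noncomputable def pebblingNumber (V : Type*) [Fintype V] [DecidableEq V] (G : SimpleGraph V) : ℕ :=
  sInf {t : ℕ | ∀ D : V → ℕ, ∀ r : V, (∑ v, D v) = t → PebSolvable G D r}

/-- The distribution after moving one pebble from `u` to `v`. -/
def pebMove {V : Type*} [DecidableEq V] (D : V → ℕ) (u v : V) : V → ℕ :=
  Function.update (Function.update D u (D u - 2)) v (D v + 1)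

lemma pebMove_tgt {V : Type*} [DecidableEq V] (D : V → ℕ) (u v : V) :
    pebMove D u v v = D v + 1 := by simp [pebMove]

lemma pebMove_src {V : Type*} [DecidableEq V] (D : V → ℕ) (u v : V) (h : u ≠ v) :
    pebMove D u v u = D u - 2 := by simp [pebMove, Function.update_of_ne h]

lemma pebMove_other {V : Type*} [DecidableEq V] (D : V → ℕ) (u v w : V) (h : w ≠ u)
    (h' : w ≠ v) : pebMove D u v w = D w := by
  simp [pebMove, Function.update_of_ne h, Function.update_of_ne h']

lemma PebSolvable.step {V : Type*} [DecidableEq V] {G : SimpleGraph V} {D : V → ℕ} {r u v : V}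
    (ha : G.Adj u v) (h2 : 2 ≤ D u) (h : PebSolvable G (pebMove D u v) r) :
    PebSolvable G D r := by
  obtain ⟨D', h1, h3⟩ := h
  exact ⟨D', Relation.ReflTransGen.head ⟨u, v, ha, h2, rfl⟩ h1, h3⟩

lemma pebSolvable_of_adj {V : Type*} [DecidableEq V] {G : SimpleGraph V} {D : V → ℕ} {r u : V}
    (ha : G.Adj u r) (h2 : 2 ≤ D u) : PebSolvable G D r :=
  PebSolvable.step ha h2 ⟨_, Relation.ReflTransGen.refl, by simp [pebMove_tgt]⟩

lemma pebSolvable_of_four {V : Type*} [DecidableEq V] {G : SimpleGraph V}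
    (hG : ∀ u v, u ≠ v → G.Adj u v ∨ ∃ w, G.Adj u w ∧ G.Adj w v)
    {D : V → ℕ} {r u : V} (h4 : 4 ≤ D u) : PebSolvable G D r := by
  by_cases hur : u = r
  · subst hur
    exact ⟨D, Relation.ReflTransGen.refl, by omega⟩
  rcases hG u r hur with h | ⟨x, h1, h2⟩
  · exact pebSolvable_of_adj h (by omega)
  · refine PebSolvable.step h1 (by omega) (PebSolvable.step h1 ?_ (pebSolvable_of_adj h2 ?_))
    · rw [pebMove_src _ _ _ h1.ne]; omega
    · rw [pebMove_tgt, pebMove_tgt]; omega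

lemma pebSolvable_card {V : Type*} [Fintype V] [DecidableEq V] {G : SimpleGraph V}
    (hG : ∀ u v, u ≠ v → G.Adj u v ∨ ∃ w, G.Adj u w ∧ G.Adj w v)
    (D : V → ℕ) (r : V) (hD : ∑ v, D v = Fintype.card V + 1) : PebSolvable G D r := by
  by_contra hN
  have hr : D r = 0 := by
    by_contra h
    exact hN ⟨D, Relation.ReflTransGen.refl, by omega⟩
  have h3 : ∀ v, D v ≤ 3 := by
    intro v
    by_contra h
    exact hN (pebSolvable_of_four hG (u := v) (by omega))
  have hf : ∀ u, ∃ x, 2 ≤ D u → G.Adj u x ∧ G.Adj x r := by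
    intro u
    by_cases hu : 2 ≤ D u
    · have hur : u ≠ r := by rintro rfl; omega
      rcases hG u r hur with h | ⟨x, hx⟩
      · exact (hN (pebSolvable_of_adj h hu)).elim
      · exact ⟨x, fun _ => hx⟩
    · exact ⟨u, fun h => (hu h).elim⟩
  choose f hf using hf
  have hf0 : ∀ u, 2 ≤ D u → D (f u) = 0 := by
    intro u hu
    obtain ⟨h1, h2⟩ := hf u hu
    by_contra h
    exact hN (PebSolvable.step h1 hu (pebSolvable_of_adj h2 (by rw [pebMove_tgt]; omega)))
  -- two big vertices have no common neighbour adjacent to the root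
  have hcom : ∀ u v x, u ≠ v → 2 ≤ D u → 2 ≤ D v → G.Adj u x → G.Adj v x → G.Adj x r → False := by
    intro u v x huv hu hv hux hvx hxr
    refine hN (PebSolvable.step hux hu (PebSolvable.step hvx ?_ (pebSolvable_of_adj hxr ?_)))
    · rw [pebMove_other _ _ _ _ huv.symm hvx.ne]; exact hv
    · rw [pebMove_tgt, pebMove_tgt]; omega
  -- note that the common neighbour may also lie outside the neighbourhood of the root
  have hcom2 : ∀ u v, u ≠ v → D u = 3 → D v = 3 →
      ∃ w, G.Adj u w ∧ G.Adj v w ∧ D w = 0 ∧ w ≠ r ∧ ¬ G.Adj w r := by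
    intro u v huv hu hv
    rcases hG u v huv with h | ⟨w, h1, h2⟩
    · refine (hN (PebSolvable.step h (by omega) (pebSolvable_of_four hG (u := v) ?_))).elim
      rw [pebMove_tgt]; omega
    · refine ⟨w, h1, h2.symm, ?_, ?_, fun h => hcom u v w huv (by omega) (by omega) h1 h2.symm h⟩
      · by_contra h
        refine hN (PebSolvable.step h1 (by omega) (PebSolvable.step h2 ?_
          (pebSolvable_of_four hG (u := v) ?_)))
        · rw [pebMove_tgt]; omega
        · rw [pebMove_tgt, pebMove_other _ _ _ _ huv.symm h2.symm.ne]; omega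
      · rintro rfl
        exact hN (pebSolvable_of_adj h1 (by omega))
  have hthree : ∀ u v t w, u ≠ v → u ≠ t → v ≠ t → D u = 3 → D v = 3 → D t = 3 →
      G.Adj u w → G.Adj v w → G.Adj t w → False := by
    intro u v t w huv hut hvt hu hv ht huw hvw htw
    refine hN (PebSolvable.step huw (by omega) (PebSolvable.step hvw ?_
      (PebSolvable.step htw.symm ?_ (pebSolvable_of_four hG (u := t) ?_))))
    · rw [pebMove_other _ _ _ _ huv.symm hvw.ne]; omega
    · rw [pebMove_tgt, pebMove_tgt]; omega
    · rw [pebMove_tgt, pebMove_other _ _ _ _ hvt.symm htw.ne,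
        pebMove_other _ _ _ _ hut.symm htw.ne]; omega
  let Z := Finset.univ.filter (fun v => D v = 0)
  let B := Finset.univ.filter (fun v => 2 ≤ D v)
  let T := Finset.univ.filter (fun v => D v = 3)
  have hcount : B.card + T.card = Z.card + 1 := by
    have h : ∑ v, (D v + if D v = 0 then 1 else 0)
        = ∑ v, (1 + (if 2 ≤ D v then 1 else 0) + (if D v = 3 then 1 else 0)) := by
      refine Finset.sum_congr rfl fun v _ => ?_
      have := h3 v
      split_ifs <;> omega
    simp only [Finset.sum_add_distrib, ← Finset.card_filter, hD] at h
    simp only [Finset.sum_const, Finset.card_univ, smul_eq_mul, mul_one] at h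
    change _ + Z.card = _ + B.card + T.card at h
    omega
  have hfinj : Set.InjOn f B := by
    intro u hu v hv huv
    by_contra hne
    simp only [B, Finset.coe_filter, Finset.mem_univ, true_and, Set.mem_setOf_eq] at hu hv
    exact hcom u v (f u) hne hu hv (hf u hu).1 (huv ▸ (hf v hv).1) (hf u hu).2
  have hrB : r ∉ B.image f := by
    intro h
    obtain ⟨u, hu, h⟩ := Finset.mem_image.1 h
    have h2 := (hf u (by simpa [B] using hu)).2
    exact h2.ne h
  have hcB : (insert r (B.image f)).card = B.card + 1 := by
    rw [Finset.card_insert_of_notMem hrB, Finset.card_image_of_injOn hfinj]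
  have hsB : insert r (B.image f) ⊆ Z := by
    intro x hx
    rcases Finset.mem_insert.1 hx with rfl | hx
    · simpa [Z] using hr
    · obtain ⟨u, hu, rfl⟩ := Finset.mem_image.1 hx
      simpa [Z] using hf0 u (by simpa [B] using hu)
  rcases T.eq_empty_or_nonempty with hT | ⟨u, huT⟩
  · have := Finset.card_le_card hsB
    rw [hT, Finset.card_empty] at hcount
    omega
  have hu : D u = 3 := by simpa [T] using huT
  have hg : ∀ v, ∃ w, u ≠ v → D v = 3 →
      G.Adj u w ∧ G.Adj v w ∧ D w = 0 ∧ w ≠ r ∧ ¬ G.Adj w r := by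
    intro v
    by_cases h : u ≠ v ∧ D v = 3
    · obtain ⟨w, hw⟩ := hcom2 u v h.1 hu h.2
      exact ⟨w, fun _ _ => hw⟩
    · exact ⟨v, fun h1 h2 => (h ⟨h1, h2⟩).elim⟩
  choose g hg using hg
  have hmem : ∀ v ∈ T.erase u, u ≠ v ∧ D v = 3 := by
    intro v hv
    rw [Finset.mem_erase] at hv
    exact ⟨hv.1.symm, by simpa [T] using hv.2⟩
  have hginj : Set.InjOn g (T.erase u : Finset V) := by
    intro v hv t ht hvt
    obtain ⟨hv1, hv2⟩ := hmem v hv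
    obtain ⟨ht1, ht2⟩ := hmem t ht
    by_contra hne
    exact hthree u v t (g v) hv1 ht1 hne hu hv2 ht2 (hg v hv1 hv2).1 (hg v hv1 hv2).2.1
      (hvt ▸ (hg t ht1 ht2).2.1)
  have hdisj : Disjoint (insert r (B.image f)) ((T.erase u).image g) := by
    rw [Finset.disjoint_left]
    intro x hx hx'
    obtain ⟨v, hv, rfl⟩ := Finset.mem_image.1 hx'
    obtain ⟨hv1, hv2⟩ := hmem v hv
    obtain ⟨-, -, -, h4, h5⟩ := hg v hv1 hv2
    rcases Finset.mem_insert.1 hx with h | h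
    · exact h4 h
    · obtain ⟨y, hy, h⟩ := Finset.mem_image.1 h
      exact h5 (h ▸ (hf y (by simpa [B] using hy)).2)
  have hsub : insert r (B.image f) ∪ (T.erase u).image g ⊆ Z := by
    refine Finset.union_subset hsB ?_
    intro x hx
    obtain ⟨v, hv, rfl⟩ := Finset.mem_image.1 hx
    obtain ⟨hv1, hv2⟩ := hmem v hv
    simpa [Z] using (hg v hv1 hv2).2.2.1
  have hle := Finset.card_le_card hsub
  rw [Finset.card_union_of_disjoint hdisj, hcB, Finset.card_image_of_injOn hginj,
    Finset.card_erase_of_mem huT] at hle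
  have : 0 < T.card := Finset.card_pos.2 ⟨u, huT⟩
  omega

theorem diameter_two_pebbling {V : Type*} [Fintype V] [DecidableEq V]
    (G : SimpleGraph V) (hG : G.Connected) (hd : G.diam = 2) :
    pebblingNumber V G ≤ Fintype.card V + 1 := by
  apply Nat.sInf_le
  intro D r hD
  refine pebSolvable_card ?_ D r hD
  intro u v huv
  have hle : G.dist u v ≤ 2 := by
    rw [← hd]
    have : Nonempty V := ⟨u⟩
    exact SimpleGraph.dist_le_diam (SimpleGraph.connected_iff_ediam_ne_top.1 hG)
  obtain ⟨p, hp⟩ := hG.exists_walk_length_eq_dist u v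
  rw [← hp] at hle
  match p, hle with
  | .nil, _ => exact (huv rfl).elim
  | .cons h .nil, _ => exact Or.inl h
  | .cons h (.cons h' .nil), _ => exact Or.inr ⟨_, h, h'⟩
  | .cons _ (.cons _ (.cons _ q)), hle =>
    simp only [SimpleGraph.Walk.length_cons] at hle
    omega
end

section
/- The Lemke graph L does not have the 2-pebbling property: f(L) = 8, and the distribution placing 8 pebbles on a, 1 each on b, c, d, z, and 0 on w, x, y (size 12 = 2·8 − 5 + 1 with support size 5) cannot move two pebbles to the root x. -/
/-- The size of the support of a distribution. -/
def supportSize {V : Type*} [Fintype V] (D : V → ℕ) : ℕ :=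
  (Finset.univ.filter fun v => 0 < D v).card

/-- `G` has the 2-pebbling property: every distribution `D` of size at least
`2 f(G) - q(D) + 1` can move two pebbles to any specified root. -/
def TwoPebbling (V : Type*) [Fintype V] [DecidableEq V] (G : SimpleGraph V) : Prop :=
  ∀ D : V → ℕ, ∀ r : V, 2 * pebblingNumber V G - supportSize D + 1 ≤ ∑ v, D v →
    ∃ D' : V → ℕ, Relation.ReflTransGen (PebStep G) D D' ∧ 2 ≤ D' r

/-- The Lemke graph on vertices `a=0, b=1, c=2, d=3, w=4, x=5, y=6, z=7`:
the union of the complete bipartite graphs `{a}×{b,c,d}` and `{b,c,d}×{w,z}`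
with the path `w,x,y,z,a`. -/
def lemkeGraph : SimpleGraph (Fin 8) :=
  SimpleGraph.fromRel fun u v => (u, v) ∈
    [((0 : Fin 8), (1 : Fin 8)), (0, 2), (0, 3), (1, 4), (1, 7), (2, 4), (2, 7),
      (3, 4), (3, 7), (4, 5), (5, 6), (6, 7), (7, 0)]

open Relation

/-- Directed edges of the Lemke graph. -/
def lkEdges : List (ℕ × ℕ) :=
  [(0, 1), (0, 2), (0, 3), (1, 4), (1, 7), (2, 4), (2, 7), (3, 4), (3, 7), (4, 5), (5, 6),
    (6, 7), (7, 0), (1, 0), (2, 0), (3, 0), (4, 1), (7, 1), (4, 2), (7, 2), (4, 3), (7, 3),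
    (5, 4), (6, 5), (7, 6), (0, 7)]

theorem lkEdges_adj : ∀ p ∈ lkEdges, ∃ (h1 : p.1 < 8) (h2 : p.2 < 8),
    lemkeGraph.Adj ⟨p.1, h1⟩ ⟨p.2, h2⟩ := by
  simp only [lemkeGraph, SimpleGraph.fromRel_adj]
  decide

/-- Pointwise comparison of configurations. -/
def lkLe : List ℕ → List ℕ → Bool
  | [], _ => true
  | _ :: _, [] => false
  | m :: ms, d :: ds => Nat.ble m d && lkLe ms ds

/-- Undo a move from `u` to `v`. -/
def lkBack (l : List ℕ) (u v : ℕ) : List ℕ :=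
  let l1 := l.set v (l.getD v 0 - 1)
  l1.set u (l1.getD u 0 + 2)

/-- Evaluate a number before passing it on (keeps kernel evaluation cheap). -/
def lkForceNat (n : ℕ) (c : ℕ → Bool) : Bool :=
  Nat.rec (c 0) (fun k _ => c (k + 1)) n

theorem lkForceNat_eq (n : ℕ) (c : ℕ → Bool) : lkForceNat n c = c n := by
  cases n <;> rfl

/-- Evaluate a list of numbers before passing it on. -/
def lkForce : List ℕ → (List ℕ → Bool) → Bool
  | [], c => c []
  | h :: t, c => lkForceNat h fun h' => lkForce t fun t' => c (h' :: t')

theorem lkForce_eq : ∀ (l : List ℕ) (c : List ℕ → Bool), lkForce l c = c l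
  | [], _ => rfl
  | h :: t, c => by rw [lkForce, lkForceNat_eq, lkForce_eq t]

/-- All predecessors of a configuration. -/
def lkPreds (l : List ℕ) : List (List ℕ) :=
  lkEdges.flatMap fun e => bif Nat.ble 1 (l.getD e.2 0) then [lkBack l e.1 e.2] else []

/-- Add the candidates that are not dominated by known configurations. -/
def lkProc : List (List ℕ) → List (List ℕ) → List (List ℕ) →
    (List (List ℕ) → List (List ℕ) → Bool) → Bool
  | [], acc, new, c => c acc new
  | m :: ms, acc, new, c => lkForce m fun mm =>
      bif acc.any (fun q => lkLe q mm) then lkProc ms acc new c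
      else lkProc ms (mm :: acc) (mm :: new) c

/-- Backward search. -/
def lkSearch : ℕ → List (List ℕ) → List (List ℕ) → (List (List ℕ) → Bool) → Bool
  | 0, acc, _, c => c acc
  | n + 1, acc, lev, c =>
    lkProc (lev.flatMap lkPreds) acc [] fun acc' new => lkSearch n acc' new c

/-- Pass on the tails of those lists whose head is at most `k`. -/
def lkFilt (k : ℕ) : List (List ℕ) → List (List ℕ) → (List (List ℕ) → Bool) → Bool
  | [], acc, c => c acc
  | [] :: ms, acc, c => lkFilt k ms acc c
  | (h :: tl) :: ms, acc, c =>
    bif Nat.ble h k then lkFilt k ms (tl :: acc) c else lkFilt k ms acc c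

theorem lkFilt_sound (k : ℕ) : ∀ (ms acc : List (List ℕ)) (c : List (List ℕ) → Bool),
    lkFilt k ms acc c = true → ∃ out, c out = true ∧
      ∀ tl ∈ out, tl ∈ acc ∨ ∃ h, h ≤ k ∧ h :: tl ∈ ms
  | [], acc, c, h => ⟨acc, h, fun _ ht => Or.inl ht⟩
  | [] :: ms, acc, c, h => by
    obtain ⟨out, ho, hm⟩ := lkFilt_sound k ms acc c h
    refine ⟨out, ho, fun tl ht => (hm tl ht).imp_right ?_⟩
    rintro ⟨x, hx, hx'⟩
    exact ⟨x, hx, List.mem_cons_of_mem _ hx'⟩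
  | (x :: tl) :: ms, acc, c, h => by
    cases hb : Nat.ble x k
    · simp only [lkFilt, hb, cond_false] at h
      obtain ⟨out, ho, hm⟩ := lkFilt_sound k ms acc c h
      refine ⟨out, ho, fun tl ht => (hm tl ht).imp_right ?_⟩
      rintro ⟨x, hx, hx'⟩
      exact ⟨x, hx, List.mem_cons_of_mem _ hx'⟩
    · simp only [lkFilt, hb, cond_true] at h
      obtain ⟨out, ho, hm⟩ := lkFilt_sound k ms (tl :: acc) c h
      refine ⟨out, ho, fun tl' ht => ?_⟩
      rcases hm tl' ht with h1 | ⟨y, hy, hy'⟩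
      · rcases List.mem_cons.mp h1 with rfl | h1
        · exact Or.inr ⟨x, Nat.le_of_ble_eq_true hb, by simp⟩
        · exact Or.inl h1
      · exact Or.inr ⟨y, hy, List.mem_cons_of_mem _ hy'⟩

/-- Every list of length `n` and sum `t` dominates a member of the list. -/
def lkCover : ℕ → List (List ℕ) → ℕ → Bool
  | 0, ms, t => Nat.ble 1 t || ms.any List.isEmpty
  | n + 1, ms, t => (ms.any fun m => lkLe m (List.replicate (n + 1) 0)) ||
      (List.range (t + 1)).all fun k => lkFilt k ms [] fun ms' => lkCover n ms' (t - k)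

theorem lkLe_zero : ∀ (m D : List ℕ), lkLe m (List.replicate D.length 0) = true →
    lkLe m D = true
  | [], _, _ => by simp [lkLe]
  | _ :: _, [], h => h
  | m :: ms, d :: ds, h => by
    simp only [List.length_cons, List.replicate_succ, lkLe, Bool.and_eq_true] at h ⊢
    have h0 := Nat.le_of_ble_eq_true h.1
    exact ⟨Nat.ble_eq_true_of_le (h0.trans (Nat.zero_le d)), lkLe_zero ms ds h.2⟩

theorem lkCover_sound : ∀ (n : ℕ) (ms : List (List ℕ)) (t : ℕ), lkCover n ms t = true →
    ∀ D : List ℕ, D.length = n → D.sum = t → ∃ m ∈ ms, lkLe m D = true := by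
  intro n
  induction n with
  | zero =>
    intro ms t h D hD hs
    have hD' : D = [] := List.length_eq_zero_iff.mp hD
    subst hD'
    simp at hs
    subst hs
    simp [lkCover] at h
    exact ⟨[], h, rfl⟩
  | succ n ih =>
    intro ms t h D hD hs
    match D, hD, hs with
    | k :: D, hD, hs =>
      simp only [List.length_cons, Nat.add_right_cancel_iff, List.sum_cons] at hD hs
      simp only [lkCover, Bool.or_eq_true, List.any_eq_true, List.all_eq_true,
        List.mem_range] at h
      rcases h with ⟨m, hm, hle⟩ | h
      · exact ⟨m, hm, lkLe_zero m (k :: D) (by simpa [hD] using hle)⟩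
      · obtain ⟨out, ho, hout⟩ := lkFilt_sound k _ _ _ (h k (by omega))
        obtain ⟨m, hm, hle⟩ := ih _ _ ho D hD (by omega)
        rcases hout m hm with h1 | ⟨x, hx, hx'⟩
        · simp at h1
        · exact ⟨x :: m, hx', by simp [lkLe, Nat.ble_eq_true_of_le hx, hle]⟩

theorem lkLe_getD : ∀ (m D : List ℕ), lkLe m D = true → ∀ i, m.getD i 0 ≤ D.getD i 0
  | [], _, _, i => by simp
  | _ :: _, [], h, _ => by simp [lkLe] at h
  | m :: ms, d :: ds, h, i => by
    simp only [lkLe, Bool.and_eq_true] at h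
    cases i with
    | zero => simpa using Nat.le_of_ble_eq_true h.1
    | succ i => simpa using lkLe_getD ms ds h.2 i

/-- A configuration all of whose dominating distributions are solvable. -/
def LkGood (r : Fin 8) (l : List ℕ) : Prop :=
  ∀ D : Fin 8 → ℕ, (∀ v : Fin 8, l.getD v 0 ≤ D v) → PebSolvable lemkeGraph D r

theorem lkSet_getD (l : List ℕ) (i j a : ℕ) :
    (l.set i a).getD j 0 = if i = j ∧ j < l.length then a else l.getD j 0 := by
  simp only [List.getD_eq_getElem?_getD, List.getElem?_set]
  split_ifs <;> simp_all

theorem lkBack_good (r : Fin 8) (l : List ℕ) (hl : l.length = 8) (hg : LkGood r l) (e : ℕ × ℕ)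
    (he : e ∈ lkEdges) (h1 : 1 ≤ l.getD e.2 0) : LkGood r (lkBack l e.1 e.2) := by
  obtain ⟨hu, hv, hadj⟩ := lkEdges_adj e he
  obtain ⟨u, v⟩ := e
  simp only at hu hv hadj h1 ⊢
  have huv : u ≠ v := by
    rintro rfl
    exact hadj.ne rfl
  intro D hD
  have hval : ∀ j : Fin 8, (lkBack l u v).getD j 0 =
      if u = j then l.getD j 0 + 2 else if v = j then l.getD j 0 - 1 else l.getD j 0 := by
    intro j
    have hj := j.2
    simp only [lkBack, lkSet_getD, List.length_set, hl]
    split_ifs <;> grind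
  have hDu := hD ⟨u, hu⟩
  rw [hval] at hDu
  simp only [if_true] at hDu
  obtain ⟨D', hD', hr⟩ := hg (Function.update (Function.update D ⟨u, hu⟩ (D ⟨u, hu⟩ - 2))
    ⟨v, hv⟩ (D ⟨v, hv⟩ + 1)) (by
      intro j
      have hj := hD j
      rw [hval] at hj
      simp only [Function.update_apply, Fin.ext_iff]
      split_ifs with h2 h3
      · have : j = ⟨v, hv⟩ := Fin.ext h2
        subst this
        simp [huv] at hj ⊢
        omega
      · have : j = ⟨u, hu⟩ := Fin.ext h3
        subst this
        simp at hj ⊢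
        omega
      · rw [if_neg (fun h => h3 h.symm), if_neg (fun h => h2 h.symm)] at hj
        exact hj)
  exact ⟨D', ReflTransGen.head ⟨_, _, hadj, by omega, rfl⟩ hD', hr⟩

theorem lkPreds_good (r : Fin 8) (l : List ℕ) (hl : l.length = 8 ∧ LkGood r l) :
    ∀ m ∈ lkPreds l, m.length = 8 ∧ LkGood r m := by
  intro m hm
  simp only [lkPreds, List.mem_flatMap] at hm
  obtain ⟨e, he, hm⟩ := hm
  cases hb : Nat.ble 1 (l.getD e.2 0)
  · simp only [hb, cond_false, List.not_mem_nil] at hm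
  · simp only [hb, cond_true, List.mem_singleton] at hm
    subst hm
    exact ⟨by simp [lkBack, hl.1], lkBack_good r l hl.1 hl.2 e he (Nat.le_of_ble_eq_true hb)⟩

theorem lkProc_sound (P : List ℕ → Prop) : ∀ (ms acc new : List (List ℕ))
    (c : List (List ℕ) → List (List ℕ) → Bool), lkProc ms acc new c = true →
    (∀ m ∈ ms, P m) → (∀ m ∈ acc, P m) → (∀ m ∈ new, P m) →
    ∃ acc' new', c acc' new' = true ∧ (∀ m ∈ acc', P m) ∧ (∀ m ∈ new', P m)
  | [], acc, new, c, h, _, h1, h2 => ⟨acc, new, h, h1, h2⟩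
  | a :: ms, acc, new, c, h, h0, h1, h2 => by
    have ha := h0 a (by simp)
    have h0' : ∀ m ∈ ms, P m := fun m hm => h0 m (List.mem_cons_of_mem _ hm)
    rw [lkProc, lkForce_eq] at h
    cases hb : acc.any (fun q => lkLe q a)
    · rw [hb, cond_false] at h
      exact lkProc_sound P ms _ _ c h h0' (List.forall_mem_cons.mpr ⟨ha, h1⟩)
        (List.forall_mem_cons.mpr ⟨ha, h2⟩)
    · rw [hb, cond_true] at h
      exact lkProc_sound P ms _ _ c h h0' h1 h2

theorem lkSearch_sound (r : Fin 8) : ∀ (n : ℕ) (acc lev : List (List ℕ))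
    (c : List (List ℕ) → Bool), lkSearch n acc lev c = true →
    (∀ m ∈ acc, m.length = 8 ∧ LkGood r m) → (∀ m ∈ lev, m.length = 8 ∧ LkGood r m) →
    ∃ out, c out = true ∧ ∀ m ∈ out, m.length = 8 ∧ LkGood r m
  | 0, acc, _, _, hc, h, _ => ⟨acc, hc, h⟩
  | n + 1, acc, lev, c, hc, h, h' => by
    obtain ⟨acc', new', h1, h2, h3⟩ := lkProc_sound (fun m => m.length = 8 ∧ LkGood r m)
      _ _ _ _ hc
      (by
        intro m hm
        rw [List.mem_flatMap] at hm
        obtain ⟨l, hl, hm⟩ := hm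
        exact lkPreds_good r l (h' l hl) m hm) h (by simp)
    exact lkSearch_sound r n _ _ c h1 h2 h3

/-- One pebble on the root. -/
def lkUnit (r : ℕ) : List ℕ := (List.replicate 8 0).set r 1

theorem lkUnit_good (r : Fin 8) : (lkUnit r).length = 8 ∧ LkGood r (lkUnit r) := by
  refine ⟨by simp [lkUnit], fun D hD => ⟨D, ReflTransGen.refl, ?_⟩⟩
  have := hD r
  rw [lkUnit, lkSet_getD] at this
  simpa using this

/-- The check for root `r`. -/
def lkCheck (r : ℕ) : Bool := lkSearch 7 [lkUnit r] [lkUnit r] fun ms => lkCover 8 ms 8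

set_option maxRecDepth 100000 in
theorem lkCheck_true : ∀ r : Fin 8, lkCheck r = true := by
  decide +kernel

theorem lk_upper (D : Fin 8 → ℕ) (r : Fin 8) (h : ∑ v, D v = 8) : PebSolvable lemkeGraph D r := by
  have hu : ∀ m ∈ [lkUnit r], m.length = 8 ∧ LkGood r m := by
    intro m hm
    rw [List.mem_singleton.mp hm]
    exact lkUnit_good r
  obtain ⟨ms, hc, hms⟩ := lkSearch_sound r 7 _ _ _ (lkCheck_true r) hu hu
  obtain ⟨m, hm, hle⟩ := lkCover_sound 8 ms 8 hc (List.ofFn D) (by simp)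
    (by rw [List.sum_ofFn, h])
  refine (hms m hm).2 D fun v => ?_
  have := lkLe_getD _ _ hle v
  rwa [show (List.ofFn D).getD v 0 = D v by
    simp [List.getD_eq_getElem?_getD, -List.ofFn_succ]] at this

/-- If every vertex has at most one pebble, nothing can be moved. -/
theorem lk_stuck (D D' : Fin 8 → ℕ) (hD : ∀ v, D v ≤ 1)
    (h : ReflTransGen (PebStep lemkeGraph) D D') : D' = D := by
  induction h with
  | refl => rfl
  | tail _ hs ih =>
    subst ih
    obtain ⟨u, v, _, h2, _⟩ := hs
    have := hD u
    omega

theorem lk_lower (t : ℕ) (ht : t < 8) :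
    ∃ D : Fin 8 → ℕ, ∃ r : Fin 8, ∑ v, D v = t ∧ ¬ PebSolvable lemkeGraph D r := by
  refine ⟨fun v => if v.val < t then 1 else 0, 7, ?_, ?_⟩
  · interval_cases t <;> decide
  · rintro ⟨D', h, h1⟩
    rw [lk_stuck _ D' (fun v => by split_ifs <;> simp) h] at h1
    have h7 : ¬ (7 < t) := by omega
    simp [h7] at h1

theorem lk_number : pebblingNumber (Fin 8) lemkeGraph = 8 := by
  unfold pebblingNumber
  apply le_antisymm
  · exact Nat.sInf_le fun D r h => lk_upper D r h
  · by_contra hlt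
    push Not at hlt
    obtain ⟨D, r, hs, hn⟩ := lk_lower _ hlt
    have hmem := Nat.sInf_mem (s := {t : ℕ | ∀ D : Fin 8 → ℕ, ∀ r : Fin 8, (∑ v, D v) = t →
      PebSolvable lemkeGraph D r}) ⟨8, fun D r h => lk_upper D r h⟩
    exact hn (hmem D r hs)

/-- Balance equations for a sequence of pebbling steps. -/
theorem lk_flow (D D' : Fin 8 → ℕ) (h : ReflTransGen (PebStep lemkeGraph) D D') :
    ∃ n : Fin 8 → Fin 8 → ℕ, (∀ u v, ¬ lemkeGraph.Adj u v → n u v = 0) ∧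
      ∀ v, D' v + 2 * ∑ u, n v u = D v + ∑ u, n u v := by
  induction h with
  | refl => exact ⟨fun _ _ => 0, fun _ _ _ => rfl, by simp⟩
  | @tail D1 D2 _ hs ih =>
    obtain ⟨n, hn, hb⟩ := ih
    obtain ⟨u, v, hadj, h2, rfl⟩ := hs
    refine ⟨fun i j => n i j + if i = u ∧ j = v then 1 else 0, ?_, ?_⟩
    · intro i j hij
      have : ¬ (i = u ∧ j = v) := by
        rintro ⟨rfl, rfl⟩
        exact hij hadj
      simp [hn i j hij, this]
    · intro j
      have hj := hb j
      have e1 : (∑ i, if j = u ∧ i = v then 1 else 0) = if j = u then 1 else 0 := by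
        by_cases hju : j = u <;> simp [hju]
      have e2 : (∑ i, if i = u ∧ j = v then 1 else 0) = if j = v then 1 else 0 := by
        by_cases hju : j = v <;> simp [hju]
      simp only [Finset.sum_add_distrib, e1, e2, Function.update_apply]
      have hne := hadj.ne
      by_cases hjv : j = v
      · subst hjv
        simp [hne.symm]
        omega
      · by_cases hju : j = u
        · subst hju
          simp [hne]
          omega
        · simp [hjv, hju]
          omega

theorem lk_unsolvable : ¬ (∃ D' : Fin 8 → ℕ,
    ReflTransGen (PebStep lemkeGraph) ![8, 1, 1, 1, 0, 0, 0, 1] D' ∧ 2 ≤ D' 5) := by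
  rintro ⟨D', h, h2⟩
  obtain ⟨n, hn, hb⟩ := lk_flow _ _ h
  simp only [lemkeGraph, SimpleGraph.fromRel_adj] at hn
  have e0 := hb 0
  have e1 := hb 1
  have e2 := hb 2
  have e3 := hb 3
  have e4 := hb 4
  have e5 := hb 5
  have e6 := hb 6
  have e7 := hb 7
  have z : ∀ u v : Fin 8, (u.val, v.val) ∉ lkEdges → n u v = 0 := by
    intro u v huv
    apply hn
    revert u v
    decide
  simp (disch := decide) only [Fin.sum_univ_eight, z] at e0 e1 e2 e3 e4 e5 e6 e7
  simp at e0 e1 e2 e3 e4 e5 e6 e7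
  clear z hn hb h
  generalize D' 0 = d0 at *
  generalize D' 1 = d1 at *
  generalize D' 2 = d2 at *
  generalize D' 3 = d3 at *
  generalize D' 4 = d4 at *
  generalize D' 5 = d5 at *
  generalize D' 6 = d6 at *
  generalize D' 7 = d7 at *
  have hz : d0 + d1 + d2 + d3 + d7 + d4 + d6 + (n 1 0 + n 2 0 + n 3 0 + n 7 0)
      + (n 1 7 + n 2 7 + n 3 7 + n 7 1 + n 7 2 + n 7 3)
      + (n 4 1 + n 4 2 + n 4 3 + n 6 7 + n 5 4 + n 5 6) = 0 := by
    have hw : d0 + 2 * (d1 + d2 + d3 + d7) + 4 * (d4 + d6) + 8 * d5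
        + 3 * (n 1 0 + n 2 0 + n 3 0 + n 7 0)
        + 2 * (n 1 7 + n 2 7 + n 3 7 + n 7 1 + n 7 2 + n 7 3)
        + 6 * (n 4 1 + n 4 2 + n 4 3 + n 6 7) + 12 * (n 5 4 + n 5 6) = 16 := by
      zify at e0 e1 e2 e3 e4 e5 e6 e7 ⊢
      linear_combination e0 + 2 * (e1 + e2 + e3 + e7) + 4 * (e4 + e6) + 8 * e5
    clear e0 e1 e2 e3 e4 e5 e6 e7
    omega
  simp only [Nat.add_eq_zero_iff] at hz
  obtain ⟨⟨⟨⟨⟨⟨⟨⟨⟨f0, f1⟩, f2⟩, f3⟩, f7⟩, f4⟩, f6⟩, ⟨⟨a1, a2⟩, a3⟩, a4⟩,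
    ⟨⟨⟨⟨b1, b2⟩, b3⟩, b4⟩, b5⟩, b6⟩, ⟨⟨⟨⟨c1, c2⟩, c3⟩, c4⟩, c5⟩, c6⟩ := hz
  simp only [a1, a2, a3, a4, b1, b2, b3, b4, b5, b6, c1, c2, c3, c4, c5, c6, f0, f1, f2, f3, f4,
    f6, f7] at e0 e1 e2 e3 e4 e5 e6 e7
  have g1 : n 0 1 = 1 := by omega
  have g2 : n 0 2 = 1 := by omega
  have g3 : n 0 3 = 1 := by omega
  omega

theorem lemke_not_two_pebbling :
    pebblingNumber (Fin 8) lemkeGraph = 8 ∧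
      ¬ (∃ D' : Fin 8 → ℕ,
          Relation.ReflTransGen (PebStep lemkeGraph) ![8, 1, 1, 1, 0, 0, 0, 1] D' ∧
            2 ≤ D' 5) ∧
      ¬ TwoPebbling (Fin 8) lemkeGraph := by
  refine ⟨lk_number, lk_unsolvable, fun h => lk_unsolvable ?_⟩
  apply h
  rw [lk_number]
  decide
end

section
/- For any set {n_1,…,n_q} of q natural numbers there exists a nonempty index set I ⊆ {1,…,q} such that q divides Σ_{i∈I} n_i and Σ_{i∈I} gcd(q, n_i) ≤ q. -/
/-- Pebbling reachability on multisets of positive integers. -/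
inductive KLReach : Multiset ℕ → Multiset ℕ → Prop
  | refl (s) : KLReach s s
  | trans {s t u} : KLReach s t → KLReach t u → KLReach s u
  | add {s t s' t'} : KLReach s t → KLReach s' t' → KLReach (s + s') (t + t')
  | step (p d : ℕ) : 0 < p → KLReach (Multiset.replicate p d) {p * d}
  | drop (s) : KLReach s 0

theorem KLReach.scale (c : ℕ) {s t : Multiset ℕ} (h : KLReach s t) :
    KLReach (s.map (c * ·)) (t.map (c * ·)) := by
  induction h with
  | refl s => exact .refl _
  | trans _ _ h1 h2 => exact .trans h1 h2
  | add _ _ h1 h2 => rw [Multiset.map_add, Multiset.map_add]; exact .add h1 h2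
  | step p d hp =>
    rw [Multiset.map_replicate, Multiset.map_singleton, mul_left_comm]
    exact .step p (c * d) hp
  | drop s => exact .drop _

theorem KLReach.of_le {s t : Multiset ℕ} (h : t ≤ s) : KLReach s t := by
  obtain ⟨u, rfl⟩ := Multiset.le_iff_exists_add.1 h
  simpa using KLReach.add (.refl t) (.drop u)

theorem KLReach.nsmul (p : ℕ) (hp : 0 < p) (u : Multiset ℕ) :
    KLReach (p • u) (u.map (p * ·)) := by
  induction u using Multiset.induction_on with
  | empty => simpa using KLReach.refl 0
  | cons a u ih =>
    rw [← Multiset.singleton_add, nsmul_add, Multiset.map_add, Multiset.nsmul_singleton,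
      Multiset.map_singleton]
    exact .add (.step p a hp) ih

/-- Extract `c` groups of `p` equal elements. -/
theorem kl_shift (p : ℕ) (hp : 0 < p) (c : ℕ) : ∀ s : Multiset ℕ,
    p * c + (p - 1) * s.toFinset.card ≤ s.card →
    ∃ u w : Multiset ℕ, u.card = c ∧ (∀ d ∈ u, d ∈ s) ∧ s = p • u + w := by
  induction c with
  | zero => intro s _; exact ⟨0, s, by simp, by simp, by simp⟩
  | succ c ih =>
    intro s hs
    have h1 : ∃ v ∈ s, p ≤ s.count v := by
      by_contra! hcon
      have h2 : s.card ≤ s.toFinset.card * (p - 1) := by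
        rw [← Multiset.toFinset_sum_count_eq s]
        have := Finset.sum_le_card_nsmul s.toFinset (fun a => s.count a) (p - 1)
          (fun x hx => by have := hcon x (by simpa using hx); omega)
        simpa using this
      rw [mul_add, mul_comm (p - 1)] at hs
      omega
    obtain ⟨v, hv, hpv⟩ := h1
    obtain ⟨s', rfl⟩ := Multiset.le_iff_exists_add.1 (Multiset.le_count_iff_replicate_le.1 hpv)
    have h3 : s'.toFinset.card ≤ (Multiset.replicate p v + s').toFinset.card := by
      apply Finset.card_le_card
      rw [Multiset.toFinset_add]; exact Finset.subset_union_right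
    have h4 := Nat.mul_le_mul_left (p - 1) h3
    rw [Multiset.card_add, Multiset.card_replicate, mul_add] at hs
    obtain ⟨u, w, h5, h6, h7⟩ := ih s' (by omega)
    refine ⟨{v} + u, w, by simp [h5, add_comm], ?_, ?_⟩
    · intro d hd
      rw [Multiset.mem_add, Multiset.mem_singleton] at hd
      rcases hd with rfl | hd
      · exact hv
      · exact Multiset.mem_add.2 (.inr (h6 d hd))
    · rw [nsmul_add, Multiset.nsmul_singleton, add_assoc, ← h7]

/-- Extract `c` groups of `p` equal elements keeping the support. -/
theorem kl_shift_keep (p : ℕ) (hp : 0 < p) (c : ℕ) (s : Multiset ℕ)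
    (hs : p * c + p * s.toFinset.card ≤ s.card) :
    ∃ u w : Multiset ℕ, u.card = c ∧ (∀ d ∈ u, d ∈ s) ∧ s = p • u + w ∧
      s.toFinset ⊆ w.toFinset := by
  obtain ⟨s', hs'⟩ := Multiset.le_iff_exists_add.1 (Multiset.dedup_le s)
  have hsub : s'.toFinset ⊆ s.toFinset := by
    intro x hx
    rw [Multiset.mem_toFinset] at *
    rw [hs']; exact Multiset.mem_add.2 (.inr hx)
  have hcard : s.card = s.toFinset.card + s'.card := by
    conv_lhs => rw [hs']
    rw [Multiset.card_add]; rfl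
  have h4 := Nat.mul_le_mul_left (p - 1) (Finset.card_le_card hsub)
  have h5 : p * s.toFinset.card = (p - 1) * s.toFinset.card + s.toFinset.card := by
    obtain ⟨p, rfl⟩ : ∃ p', p = p' + 1 := ⟨p - 1, by omega⟩
    simp [add_mul]
  obtain ⟨u, w, h6, h7, h8⟩ := kl_shift p hp c s' (by omega)
  refine ⟨u, s.dedup + w, h6, ?_, ?_, ?_⟩
  · intro d hd
    have := h7 d hd
    rw [hs']; exact Multiset.mem_add.2 (.inr this)
  · conv_lhs => rw [hs', h8]
    abel
  · intro x hx
    simp at hx ⊢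
    exact .inl hx

def KLA (q : ℕ) : Prop :=
  ∀ s : Multiset ℕ, (∀ d ∈ s, d ∣ q) → q ≤ s.card → KLReach s {q}

def KLR (q t : ℕ) : Prop :=
  ∀ s : Multiset ℕ, (∀ d ∈ s, d ∣ q) → t * q < s.card + s.toFinset.card →
    KLReach s (Multiset.replicate t q)

theorem kl_support_le (q : ℕ) (hq : 0 < q) (s : Multiset ℕ) (hs : ∀ d ∈ s, d ∣ q) :
    s.toFinset.card ≤ q := by
  refine le_trans (Finset.card_le_card (t := q.divisors) ?_) (Nat.card_divisors_le_self q)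
  intro x hx
  simp at hx
  exact Nat.mem_divisors.2 ⟨hs x hx, by omega⟩

theorem kl_support_odd (m : ℕ) (hm : Odd m) (s : Multiset ℕ) (hs : ∀ d ∈ s, d ∣ m) :
    2 * s.toFinset.card ≤ m + 1 := by
  have h : s.toFinset.card ≤ (Finset.range ((m + 1) / 2)).card := by
    refine Finset.card_le_card_of_injOn (fun d => d / 2) ?_ ?_
    · intro x hx
      have hx' : x ∈ s := by simpa using hx
      have := Nat.le_of_dvd hm.pos (hs x hx')
      have h2 := hm.of_dvd_nat (hs x hx')
      obtain ⟨a, rfl⟩ := hm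
      obtain ⟨b, rfl⟩ := h2
      simp
      omega
    · intro x hx y hy hxy
      have hx' := hm.of_dvd_nat (hs x (by simpa using hx))
      have hy' := hm.of_dvd_nat (hs y (by simpa using hy))
      obtain ⟨a, rfl⟩ := hx'
      obtain ⟨b, rfl⟩ := hy'
      simp at hxy
      omega
  rw [Finset.card_range] at h
  omega

theorem kl_exists_le (s : Multiset ℕ) (c : ℕ) (hc : c ≤ s.card) : ∃ w ≤ s, w.card = c := by
  induction s using Quotient.inductionOn with
  | _ l =>
  refine ⟨(l.take c : List ℕ), Multiset.coe_le.2 (List.take_sublist _ _).subperm, ?_⟩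
  simpa using hc

theorem kl_R_of_two (q : ℕ) (hq : 0 < q) (hA : KLA q) (h2 : KLR q 2) (t : ℕ) (ht : 2 ≤ t) :
    KLR q t := by
  induction t, ht using Nat.le_induction with
  | base => exact h2
  | succ t ht ih =>
    intro s hs hc
    have hr := kl_support_le q hq s hs
    have hle : 2 * q ≤ t * q := Nat.mul_le_mul_right q ht
    rw [add_mul] at hc
    obtain ⟨s', hs'⟩ := Multiset.le_iff_exists_add.1 (Multiset.dedup_le s)
    have hcard : s.card = s.toFinset.card + s'.card := by
      conv_lhs => rw [hs']
      rw [Multiset.card_add]; rfl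
    obtain ⟨w, hw, hwc⟩ := kl_exists_le s' q (by omega)
    obtain ⟨v, rfl⟩ := Multiset.le_iff_exists_add.1 hw
    have hs'' : s = w + (s.dedup + v) := by
      conv_lhs => rw [hs']
      abel
    have hsub : s.toFinset.card ≤ (s.dedup + v).toFinset.card := by
      apply Finset.card_le_card
      intro x hx
      simp at hx ⊢
      exact .inl hx
    have hcard2 : s.card = q + (s.dedup + v).card := by
      conv_lhs => rw [hs'', Multiset.card_add, hwc]
    have e1 : KLReach w {q} := hA w (fun d hd => hs d (by
      rw [hs'']; exact Multiset.mem_add.2 (.inl hd))) hwc.ge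
    have e2 : KLReach (s.dedup + v) (Multiset.replicate t q) := ih _ (fun d hd => hs d (by
      rw [hs'']; exact Multiset.mem_add.2 (.inr hd))) (by omega)
    rw [hs'', Multiset.replicate_succ, ← Multiset.singleton_add]
    exact .add e1 e2

theorem kl_split (p k m : ℕ) (hp : p.Prime) (hpm : Nat.Coprime p m) (s : Multiset ℕ)
    (hs : ∀ d ∈ s, d ∣ p ^ (k + 1) * m) :
    ∃ s0 s1 : Multiset ℕ, s = s0 + s1.map (p * ·) ∧ (∀ d ∈ s0, d ∣ m) ∧
      (∀ d ∈ s1, d ∣ p ^ k * m) := by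
  refine ⟨s.filter (fun d => ¬ p ∣ d), (s.filter (fun d => p ∣ d)).map (· / p), ?_, ?_, ?_⟩
  · rw [Multiset.map_map]
    have : (s.filter (fun d => p ∣ d)).map ((p * ·) ∘ (· / p)) = s.filter (fun d => p ∣ d) := by
      conv_rhs => rw [← Multiset.map_id (s.filter (fun d => p ∣ d))]
      apply Multiset.map_congr rfl
      intro x hx
      simp at hx
      simp [Nat.mul_div_cancel' hx.2]
    rw [this, add_comm, Multiset.filter_add_not]
  · intro d hd
    simp at hd
    have h1 := hs d hd.1
    refine Nat.Coprime.dvd_of_dvd_mul_left ?_ h1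
    exact (((Nat.Prime.coprime_iff_not_dvd hp).2 hd.2).symm).pow_right _
  · intro d hd
    simp only [Multiset.mem_map, Multiset.mem_filter] at hd
    obtain ⟨a, ⟨ha, e, rfl⟩, rfl⟩ := hd
    have := hs _ ha
    rw [Nat.mul_div_cancel_left _ hp.pos]
    rw [pow_succ', mul_assoc] at this
    exact Nat.dvd_of_mul_dvd_mul_left hp.pos this

theorem kl_main (q : ℕ) (hq : 0 < q) : KLA q ∧ ∀ t, 2 ≤ t → KLR q t := by
  induction q using Nat.strong_induction_on with
  | _ q IH =>
  rcases Nat.lt_or_ge 1 q with h1 | h1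
  swap
  · have : q = 1 := by omega
    subst this
    have hrep : ∀ s : Multiset ℕ, (∀ d ∈ s, d ∣ 1) → s = Multiset.replicate s.card 1 := by
      intro s hs
      exact Multiset.eq_replicate_card.2 (fun b hb => by simpa using hs b hb)
    have hA : ∀ t (s : Multiset ℕ), (∀ d ∈ s, d ∣ 1) → t ≤ s.card →
        KLReach s (Multiset.replicate t 1) := by
      intro t s hs hc
      rw [hrep s hs]
      exact .of_le ((Multiset.replicate_le_replicate 1).2 hc)
    refine ⟨fun s hs hc => hA 1 s hs hc, fun t ht s hs hc => hA t s hs ?_⟩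
    have := kl_support_le 1 one_pos s hs
    omega
  set p := q.minFac with hpdef
  have hp : p.Prime := Nat.minFac_prime (by omega)
  obtain ⟨k', m, hpm', hqe⟩ := Nat.exists_eq_pow_mul_and_not_dvd (n := q) (by omega) p hp.ne_one
  have hpm : Nat.Coprime p m := (Nat.Prime.coprime_iff_not_dvd hp).2 hpm'
  have hk : k' ≠ 0 := by
    rintro rfl
    apply hpm'
    rw [pow_zero, one_mul] at hqe
    rw [← hqe]; exact Nat.minFac_dvd q
  obtain ⟨k, rfl⟩ := Nat.exists_eq_succ_of_ne_zero hk
  have hm0 : 0 < m := by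
    rcases Nat.eq_zero_or_pos m with rfl | h
    · simp at hpm'
    · exact h
  have hmodd : Odd m := by
    rw [← Nat.not_even_iff_odd]
    intro he
    have h2m : 2 ∣ m := he.two_dvd
    have h2q : 2 ∣ q := by rw [hqe]; exact h2m.mul_left _
    have : p ≤ 2 := Nat.minFac_le_of_dvd le_rfl h2q
    have hp2 : p = 2 := le_antisymm this hp.two_le
    rw [hp2] at hpm'
    exact hpm' h2m
  clear_value p
  set Q := p ^ k * m with hQ
  have hq' : q = p * Q := by rw [hqe, hQ, Nat.succ_eq_add_one, pow_succ']; ring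
  have hQ0 : 0 < Q := by have := hp.pos; positivity
  have hp2 := hp.two_le
  have hQq : Q < q := by rw [hq']; nlinarith
  have hmQ : m ∣ Q := Dvd.intro_left _ rfl
  have hmq : m < q := lt_of_le_of_lt (Nat.le_of_dvd hQ0 hmQ) hQq
  obtain ⟨AQ, RQ⟩ := IH Q hQq hQ0
  obtain ⟨-, Rm⟩ := IH m hmq hm0
  have hpk : 2 ≤ p ^ (k + 1) := le_trans hp2 (Nat.le_self_pow (by omega) p)
  -- layer 0 to the root
  have L0 : ∀ s : Multiset ℕ, (∀ d ∈ s, d ∣ m) → q < s.card + s.toFinset.card →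
      KLReach s {q} := by
    intro s hs hc
    refine .trans (Rm (p ^ (k + 1)) hpk s hs (by rw [hqe] at hc; exact hc)) ?_
    rw [hqe]
    exact .step _ _ (by omega)
  -- upper layers to the root
  have L1 : ∀ s : Multiset ℕ, (∀ d ∈ s, d ∣ Q) → Q ≤ s.card →
      KLReach (s.map (p * ·)) {q} := by
    intro s hs hc
    have := (AQ s hs hc).scale p
    rwa [Multiset.map_singleton, ← hq'] at this
  have hA : KLA q := by
    intro s hs hc
    obtain ⟨s0, s1, rfl, hs0, hs1⟩ := kl_split p k m hp hpm s (by rw [← Nat.succ_eq_add_one, ← hqe]; exact hs)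
    rw [Multiset.card_add, Multiset.card_map] at hc
    by_cases h0 : q < s0.card + s0.toFinset.card
    · simpa using KLReach.add (L0 s0 hs0 h0) (.drop (s1.map (p * ·)))
    by_cases hN1 : Q ≤ s1.card
    · simpa using KLReach.add (.drop s0) (L1 s1 hs1 hN1)
    have hr : s0.toFinset.card ≤ s1.card := by omega
    obtain ⟨u, w, hu, hus, hsu⟩ := kl_shift p hp.pos (Q - s1.card) s0 (by
      have h4 := Nat.mul_le_mul_left (p - 1) hr
      obtain ⟨p', rfl⟩ : ∃ p', p = p' + 1 := ⟨p - 1, by omega⟩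
      rw [Nat.mul_sub, ← hq']
      simp only [Nat.add_sub_cancel] at *
      have : (p' + 1) * s1.card = p' * s1.card + s1.card := by ring
      have h6 : (p' + 1) * s1.card ≤ (p' + 1) * Q := Nat.mul_le_mul_left _ (by omega)
      rw [← hq'] at h6
      omega)
    have e1 : KLReach s0 (u.map (p * ·)) := by
      rw [hsu]
      simpa using KLReach.add (.nsmul p hp.pos u) (.drop w)
    refine .trans (.add e1 (.refl _)) ?_
    rw [← Multiset.map_add]
    apply L1
    · intro d hd
      rcases Multiset.mem_add.1 hd with h | h
      · exact (hs0 d (hus d h)).trans hmQ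
      · exact hs1 d h
    · rw [Multiset.card_add, hu]; omega
  refine ⟨hA, kl_R_of_two q hq hA ?_⟩
  intro s hs hc
  obtain ⟨s0, s1, rfl, hs0, hs1⟩ := kl_split p k m hp hpm s (by rw [← Nat.succ_eq_add_one, ← hqe]; exact hs)
  have hsupp : (s0 + s1.map (p * ·)).toFinset.card ≤ s0.toFinset.card + s1.toFinset.card := by
    rw [Multiset.toFinset_add]
    refine (Finset.card_union_le _ _).trans (Nat.add_le_add_left ?_ _)
    rw [Multiset.toFinset_map]
    exact Finset.card_image_le
  rw [Multiset.card_add, Multiset.card_map] at hc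
  have hr1 := Multiset.toFinset_card_le s1
  have h2Q : 2 * Q ≤ q := by rw [hq']; exact Nat.mul_le_mul_right Q hp2
  by_cases c1 : 2 * Q < s1.card + s1.toFinset.card
  · have := (RQ 2 le_rfl s1 hs1 c1).scale p
    rw [Multiset.map_replicate, ← hq'] at this
    simpa using KLReach.add (.drop s0) this
  have hrep : Multiset.replicate 2 q = {q} + {q} := by
    rw [Multiset.replicate_succ, Multiset.replicate_one, Multiset.singleton_add]
  rw [hrep]
  by_cases hN1 : Q ≤ s1.card
  · exact .add (L0 s0 hs0 (by omega)) (L1 s1 hs1 hN1)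
  have hodd := kl_support_odd m hmodd s0 hs0
  have hbd : p * s0.toFinset.card + s0.toFinset.card ≤ q + 1 := by
    have h3 : p * m ≤ q := by rw [hq']; exact Nat.mul_le_mul_left p (Nat.le_of_dvd hQ0 hmQ)
    nlinarith
  have hpN : p * s1.card ≤ q := by rw [hq']; exact Nat.mul_le_mul_left p (by omega)
  have hpN2 : 2 * s1.card ≤ p * s1.card := Nat.mul_le_mul_right _ hp2
  have hmul : p * (Q - s1.card) = q - p * s1.card := by rw [Nat.mul_sub, ← hq']
  obtain ⟨u, w, hu, hus, hsu, hsub⟩ := kl_shift_keep p hp.pos (Q - s1.card) s0 (by omega)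
  have hcw : s0.card = p * (Q - s1.card) + w.card := by
    conv_lhs => rw [hsu]
    rw [Multiset.card_add, Multiset.card_nsmul, hu]
  have hwr := Finset.card_le_card hsub
  have ew : KLReach w {q} := L0 w (fun d hd => hs0 d (by
    rw [hsu]; exact Multiset.mem_add.2 (.inr hd))) (by omega)
  have eu : KLReach ((u + s1).map (p * ·)) {q} := by
    apply L1
    · intro d hd
      rcases Multiset.mem_add.1 hd with h | h
      · exact (hs0 d (hus d h)).trans hmQ
      · exact hs1 d h
    · rw [Multiset.card_add, hu]; omega
  have e0 : KLReach (p • u + w + s1.map (p * ·)) (w + (u + s1).map (p * ·)) := by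
    have : w + (u + s1).map (p * ·) = u.map (p * ·) + w + s1.map (p * ·) := by
      rw [Multiset.map_add]; abel
    rw [this]
    exact .add (.add (.nsmul p hp.pos u) (.refl _)) (.refl _)
  rw [hsu]
  exact .trans e0 (.add ew eu)

/-- Among `p` integers there is a nonempty subfamily with sum divisible by `p`. -/
theorem kl_prefix {α : Type*} (p : ℕ) (hp : 0 < p) (F : Multiset α) (hF : F.card = p) (f : α → ℕ) :
    ∃ G ≤ F, G ≠ 0 ∧ p ∣ (G.map f).sum := by
  induction F using Quotient.inductionOn with
  | _ l =>
  have hl : l.length = p := by simpa using hF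
  have hmaps : ∀ i ∈ Finset.range (p + 1), ((l.take i).map f).sum % p ∈ Finset.range p := by
    intro i _
    exact Finset.mem_range.2 (Nat.mod_lt _ hp)
  obtain ⟨i, hi, j, hj, hij, he⟩ := Finset.exists_ne_map_eq_of_card_lt_of_maps_to
    (by simp) hmaps
  wlog hlt : i < j generalizing i j
  · exact this j hj i hi hij.symm he.symm (by omega)
  have hj' := Finset.mem_range.1 hj
  refine ⟨((l.take j).drop i : List α), ?_, ?_, ?_⟩
  · exact Multiset.coe_le.2 ((List.drop_sublist _ _).trans (List.take_sublist _ _)).subperm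
  · intro h
    have h' := congrArg Multiset.card h
    simp at h'
    omega
  · have h1 : ((l.take j).map f).sum = ((l.take i).map f).sum + (((l.take j).drop i).map f).sum := by
      conv_lhs => rw [← List.take_append_drop i (l.take j)]
      rw [List.map_append, List.sum_append, List.take_take, min_eq_left hlt.le]
    rw [Multiset.map_coe, Multiset.sum_coe]
    have h2 : ((l.take i).map f).sum ≡ ((l.take j).map f).sum [MOD p] := he
    have h3 := (Nat.modEq_iff_dvd' (by omega)).1 h2
    rw [h1, Nat.add_sub_cancel_left] at h3
    exact h3

def KLGood {ι : Type*} (q : ℕ) (n : ι → ℕ) (B : Multiset ι) (d : ℕ) : Prop :=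
  B ≠ 0 ∧ d ∣ (B.map n).sum ∧ (B.map (fun i => Nat.gcd q (n i))).sum ≤ d

theorem kl_realize {ι : Type*} (q : ℕ) (n : ι → ℕ) {s t : Multiset ℕ} (h : KLReach s t) :
    ∀ F : Multiset (Multiset ι), Multiset.Rel (KLGood q n) F s →
      ∃ F', Multiset.Rel (KLGood q n) F' t ∧ F'.sum ≤ F.sum := by
  induction h with
  | refl s => intro F hF; exact ⟨F, hF, le_rfl⟩
  | trans _ _ h1 h2 =>
    intro F hF
    obtain ⟨F1, hF1, l1⟩ := h1 F hF
    obtain ⟨F2, hF2, l2⟩ := h2 F1 hF1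
    exact ⟨F2, hF2, l2.trans l1⟩
  | add _ _ h1 h2 =>
    intro F hF
    obtain ⟨F1, F2, r1, r2, rfl⟩ := Multiset.rel_add_right.1 hF
    obtain ⟨G1, hG1, l1⟩ := h1 F1 r1
    obtain ⟨G2, hG2, l2⟩ := h2 F2 r2
    refine ⟨G1 + G2, hG1.add hG2, ?_⟩
    rw [Multiset.sum_add, Multiset.sum_add]
    exact add_le_add l1 l2
  | drop s => intro F _; exact ⟨0, Multiset.Rel.zero, by simp⟩
  | step p d hp =>
    intro F hF
    have hcard : F.card = p := by simpa using Multiset.card_eq_card_of_rel hF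
    have hall : ∀ B ∈ F, KLGood q n B d := by
      intro B hB
      obtain ⟨d', hd', hg⟩ := Multiset.exists_mem_of_rel_of_mem hF hB
      rwa [Multiset.eq_of_mem_replicate hd'] at hg
    obtain ⟨G, hGF, hG0, hGd⟩ := kl_prefix p hp F hcard (fun B => (B.map n).sum / d)
    have hGall : ∀ B ∈ G, KLGood q n B d := fun B hB => hall B (Multiset.mem_of_le hGF hB)
    have hGc : G.card ≤ p := hcard ▸ Multiset.card_le_card hGF
    have key : ∀ f : ι → ℕ, ((G.sum).map f).sum = (G.map (fun B => (B.map f).sum)).sum := by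
      intro f
      clear hGF hG0 hGd hGall hGc
      induction G using Multiset.induction_on with
      | empty => simp
      | cons a G ih => simp [ih]
    refine ⟨{G.sum}, ?_, ?_⟩
    · refine Multiset.Rel.cons ⟨?_, ?_, ?_⟩ Multiset.Rel.zero
      · obtain ⟨B, hB⟩ := Multiset.exists_mem_of_ne_zero hG0
        obtain ⟨G', rfl⟩ := Multiset.exists_cons_of_mem hB
        have hB0 := (hGall B hB).1
        intro h0
        rw [Multiset.sum_cons] at h0
        have h0' := congrArg Multiset.card h0
        rw [Multiset.card_add, Multiset.card_zero] at h0'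
        exact hB0 (Multiset.card_eq_zero.1 (by omega))
      · rw [key]
        have : G.map (fun B => (B.map n).sum) = G.map (fun B => d * ((B.map n).sum / d)) :=
          Multiset.map_congr rfl (fun B hB => (Nat.mul_div_cancel' (hGall B hB).2.1).symm)
        rw [this, Multiset.sum_map_mul_left, mul_comm p d]
        exact Nat.mul_dvd_mul_left d hGd
      · rw [key]
        refine (Multiset.sum_le_card_nsmul _ d ?_).trans ?_
        · intro x hx
          obtain ⟨B, hB, rfl⟩ := Multiset.mem_map.1 hx
          exact (hGall B hB).2.2
        · rw [Multiset.card_map, smul_eq_mul]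
          exact Nat.mul_le_mul_right d hGc
    · rw [Multiset.sum_singleton]
      obtain ⟨w, rfl⟩ := Multiset.le_iff_exists_add.1 hGF
      rw [Multiset.sum_add]
      exact Multiset.le_add_right _ _

theorem kleitman_lemke (q : ℕ) (hq : 0 < q) (n : Fin q → ℕ) (hn : ∀ i, 0 < n i) :
    ∃ I : Finset (Fin q), I.Nonempty ∧ (q : ℕ) ∣ ∑ i ∈ I, n i ∧
      ∑ i ∈ I, Nat.gcd q (n i) ≤ q := by
  have h := (kl_main q hq).1 ((Finset.univ : Finset (Fin q)).val.map (fun i => Nat.gcd q (n i)))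
    (by
      intro d hd
      obtain ⟨i, -, rfl⟩ := Multiset.mem_map.1 hd
      exact Nat.gcd_dvd_left _ _) (by simp)
  obtain ⟨F', hF', hle⟩ := kl_realize q n h
    ((Finset.univ : Finset (Fin q)).val.map (fun i => {i})) (by
      rw [Multiset.rel_map]
      apply Multiset.rel_refl_of_refl_on
      intro i _
      exact ⟨by simp, by simpa using Nat.gcd_dvd_right _ _, by simp⟩)
  obtain ⟨B, F0, hB, hF0, rfl⟩ := Multiset.rel_cons_right.1 hF'
  rw [Multiset.rel_zero_right] at hF0
  subst hF0
  change Multiset.sum {B} ≤ _ at hle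
  rw [Multiset.sum_singleton, Multiset.sum_map_singleton] at hle
  exact ⟨⟨B, Multiset.nodup_of_le hle Finset.univ.nodup⟩,
    Finset.nonempty_iff_ne_empty.2 (fun h => hB.1 (congrArg Finset.val h)), hB.2.1, hB.2.2⟩
end

section
/- For any natural numbers n_1,…,n_q there exists a nonempty index set I ⊆ {1,…,q} with Σ_{i∈I} n_i ≤ lcm(q, n_1, …, n_q) and q dividing Σ_{i∈I} n_i. -/
namespace EL

/-- Pebbling moves on multisets of values. -/
inductive Reach : Multiset ℕ → Multiset ℕ → Prop
  | refl (M : Multiset ℕ) : Reach M M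
  | trans (M M' M'' : Multiset ℕ) : Reach M M' → Reach M' M'' → Reach M M''
  | add (M M' K : Multiset ℕ) : Reach M M' → Reach (M + K) (M' + K)
  | drop (M : Multiset ℕ) : Reach M 0
  | merge (r g : ℕ) : 0 < r → Reach (Multiset.replicate r g) {g * r}

theorem Reach.add2 {A B C D : Multiset ℕ} (h : Reach A B) (h' : Reach C D) :
    Reach (A + C) (B + D) := by
  refine Reach.trans _ _ _ (Reach.add _ _ C h) ?_
  rw [add_comm B C, add_comm B D]
  exact Reach.add _ _ B h'

theorem Reach.sum {V : Type} (s : Finset V) (f h : V → Multiset ℕ)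
    (H : ∀ v, Reach (f v) (h v)) : Reach (∑ v ∈ s, f v) (∑ v ∈ s, h v) := by
  classical
  induction s using Finset.induction_on with
  | empty => simpa using Reach.refl _
  | insert a s ha ih =>
    rw [Finset.sum_insert ha, Finset.sum_insert ha]
    exact (H a).add2 ih

theorem Reach.of_le {A B : Multiset ℕ} (h : B ≤ A) : Reach A B := by
  obtain ⟨C, rfl⟩ := Multiset.le_iff_exists_add.1 h
  simpa using (Reach.refl B).add2 (Reach.drop C)

theorem Reach.merges (r g : ℕ) (hr : 0 < r) (t : ℕ) :
    Reach (Multiset.replicate (r * t) g) (Multiset.replicate t (g * r)) := by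
  induction t with
  | zero => simpa using Reach.refl _
  | succ t ih =>
    rw [Nat.mul_succ, Multiset.replicate_add, Multiset.replicate_add]
    exact ih.add2 (by simpa using Reach.merge r g hr)

/-- `k` pebbles can be brought to the top. -/
def S {V : Type} [Fintype V] (w : V → ℕ) (N : ℕ) (b : V → ℕ) (k : ℕ) : Prop :=
  ∀ g, Reach (∑ v, Multiset.replicate (b v) (g * w v)) (Multiset.replicate k (g * N))

section
variable {V : Type} [Fintype V] {w : V → ℕ} {N : ℕ}

theorem S.zero (b : V → ℕ) : S w N b 0 := fun g => by simpa using Reach.drop _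

theorem S.add {b b' : V → ℕ} {k k' : ℕ} (h : S w N b k) (h' : S w N b' k') :
    S w N (fun v => b v + b' v) (k + k') := by
  intro g
  simp only [Multiset.replicate_add, Finset.sum_add_distrib]
  exact (h g).add2 (h' g)

theorem S.mono {b b' : V → ℕ} {k k' : ℕ} (h : S w N b k) (hb : ∀ v, b v ≤ b' v) (hk : k' ≤ k) :
    S w N b' k' := by
  intro g
  refine Reach.trans _ _ _ (Reach.sum _ _ (fun v => Multiset.replicate (b v) (g * w v)) ?_) ?_
  · intro v
    exact Reach.of_le ((Multiset.replicate_le_replicate _).2 (hb v))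
  · exact Reach.trans _ _ _ (h g) (Reach.of_le ((Multiset.replicate_le_replicate _).2 hk))

theorem S.prod {r : ℕ} (hr : 0 < r) (b : V ⊕ V → ℕ) (t c : V → ℕ) (k0 k1 k : ℕ)
    (hb : ∀ v, r * t v + c v ≤ b (Sum.inl v))
    (h0 : S w N c (r * k0)) (h1 : S w N (fun v => b (Sum.inr v) + t v) k1) (hk : k ≤ k0 + k1) :
    S (Sum.elim w (fun v => r * w v)) (r * N) b k := by
  intro g
  rw [Fintype.sum_sum_type]
  simp only [Sum.elim_inl, Sum.elim_inr]
  have e1 : Reach (∑ v, Multiset.replicate (b (Sum.inl v)) (g * w v))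
      (∑ v, (Multiset.replicate (c v) (g * w v) + Multiset.replicate (t v) (g * r * w v))) := by
    apply Reach.sum
    intro v
    refine Reach.trans _ _ _ (Reach.of_le ((Multiset.replicate_le_replicate _).2 (hb v))) ?_
    rw [Multiset.replicate_add, add_comm]
    refine (Reach.refl _).add2 ?_
    have := Reach.merges r (g * w v) hr (t v)
    rwa [mul_right_comm] at this
  refine Reach.trans _ _ _ (e1.add2 (Reach.refl _)) ?_
  rw [Finset.sum_add_distrib, add_assoc]
  have e2 : (∑ v, Multiset.replicate (t v) (g * r * w v)) +
      (∑ v, Multiset.replicate (b (Sum.inr v)) (g * (r * w v))) =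
      ∑ v, Multiset.replicate (b (Sum.inr v) + t v) (g * r * w v) := by
    rw [← Finset.sum_add_distrib]
    refine Finset.sum_congr rfl fun v _ => ?_
    rw [Multiset.replicate_add, add_comm, mul_assoc]
  rw [e2]
  have e3 : Reach (∑ v, Multiset.replicate (c v) (g * w v))
      (Multiset.replicate k0 (g * (r * N))) := by
    refine Reach.trans _ _ _ (h0 g) ?_
    have := Reach.merges r (g * N) hr k0
    rwa [show g * N * r = g * (r * N) by ring] at this
  have e4 := h1 (g * r)
  rw [mul_assoc] at e4
  refine Reach.trans _ _ _ (e3.add2 e4) ?_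
  rw [← Multiset.replicate_add]
  exact Reach.of_le ((Multiset.replicate_le_replicate _).2 hk)

/-- choose a subconfiguration with a prescribed total -/
theorem exists_sub (t : V → ℕ) (x : ℕ) (h : x ≤ ∑ v, t v) :
    ∃ t' : V → ℕ, (∀ v, t' v ≤ t v) ∧ ∑ v, t' v = x := by
  classical
  induction x with
  | zero => exact ⟨fun _ => 0, by simp, by simp⟩
  | succ x ih =>
    obtain ⟨t', h1, h2⟩ := ih (by omega)
    have : ∃ v, t' v < t v := by
      by_contra hc
      push Not at hc
      have := Finset.sum_le_sum (s := Finset.univ) (fun v _ => hc v)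
      omega
    obtain ⟨v, hv⟩ := this
    refine ⟨fun u => t' u + if u = v then 1 else 0, ?_, ?_⟩
    · intro u
      have := h1 u
      by_cases huv : u = v
      · subst huv; simp; omega
      · simp [huv, this]
    · rw [Finset.sum_add_distrib, h2]; simp

theorem A_k (hA : ∀ b : V → ℕ, N ≤ ∑ v, b v → S w N b 1) (k : ℕ) :
    ∀ b : V → ℕ, k * N ≤ ∑ v, b v → S w N b k := by
  induction k with
  | zero => intro b _; exact S.zero b
  | succ k ih =>
    intro b hb
    rw [Nat.succ_mul] at hb
    obtain ⟨t, h1, h2⟩ := exists_sub b N (by omega)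
    have h3 : ∑ v, (b v - t v) + ∑ v, t v = ∑ v, b v := by
      rw [← Finset.sum_add_distrib]
      exact Finset.sum_congr rfl fun v _ => Nat.sub_add_cancel (h1 v)
    have h4 := S.add (ih (fun v => b v - t v) (by omega)) (hA t h2.ge)
    refine S.mono h4 (fun v => ?_) le_rfl
    have := h1 v
    omega

end

structure Base {V : Type} [Fintype V] (w : V → ℕ) (N : ℕ) : Prop where
  pos : 0 < N
  card : Fintype.card V ≤ N
  cover : ∀ d, d ∣ N → ∃ v, w v = d
  A : ∀ b : V → ℕ, N ≤ ∑ v, b v → S w N b 1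

structure Good1 {V : Type} [Fintype V] (w : V → ℕ) (N : ℕ) : Prop extends Base w N where
  C : ∀ k, 3 ≤ k → ∀ b : V → ℕ, k * N < ∑ v, b v + ∑ v, min (b v) 1 → S w N b k
  D : ∀ b : V → ℕ, 2 * N < ∑ v, b v + ∑ v, b v % 2 → S w N b 2

structure Good2 {V : Type} [Fintype V] (w : V → ℕ) (N : ℕ) : Prop extends Base w N where
  D : ∀ k, 2 ≤ k → ∀ b : V → ℕ, k * N < ∑ v, b v + ∑ v, b v % 2 → S w N b k

section
variable {V : Type} [Fintype V] {w : V → ℕ} {N : ℕ}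

theorem odd_le_occ (b : V → ℕ) : ∑ v, b v % 2 ≤ ∑ v, min (b v) 1 :=
  Finset.sum_le_sum fun v _ => by omega

theorem occ_le_sum (b : V → ℕ) : ∑ v, min (b v) 1 ≤ ∑ v, b v :=
  Finset.sum_le_sum fun v _ => by omega

theorem occ_le_card (b : V → ℕ) : ∑ v, min (b v) 1 ≤ Fintype.card V := by
  calc _ ≤ ∑ v : V, 1 := Finset.sum_le_sum fun v _ => by omega
    _ = _ := by simp

theorem Good1.toGood2 (h : Good1 w N) : Good2 w N where
  toBase := h.toBase
  D := by
    intro k hk b hb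
    rcases hk.eq_or_lt with rfl | hk
    · exact h.D b hb
    · have := odd_le_occ b
      exact h.C k hk b (by omega)

theorem Base.step (h : Base w N) {r : ℕ} (hr : r.Prime)
    (hC : ∀ b : V → ℕ, r * N < ∑ v, b v + ∑ v, min (b v % r) 1 → S w N b r) :
    Base (Sum.elim w (fun v => r * w v)) (r * N) where
  pos := Nat.mul_pos hr.pos h.pos
  card := by
    rw [Fintype.card_sum]
    have := h.card
    have := hr.two_le
    nlinarith
  cover := by
    intro d hd
    by_cases hrd : r ∣ d
    · obtain ⟨e, rfl⟩ := hrd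
      obtain ⟨v, hv⟩ := h.cover e (Nat.dvd_of_mul_dvd_mul_left hr.pos hd)
      exact ⟨Sum.inr v, by simp [hv]⟩
    · have : Nat.Coprime d r := ((Nat.Prime.coprime_iff_not_dvd hr).2 hrd).symm
      obtain ⟨v, hv⟩ := h.cover d (this.dvd_of_dvd_mul_left hd)
      exact ⟨Sum.inl v, by simp [hv]⟩
  A := by
    intro b hb
    rw [Fintype.sum_sum_type] at hb
    by_cases hc : N ≤ ∑ v, b (Sum.inr v) + ∑ v, b (Sum.inl v) / r
    · refine S.prod hr.pos b (fun v => b (Sum.inl v) / r) (fun _ => 0) 0 1 1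
        (fun v => by simpa using Nat.mul_div_le _ _) (S.zero _) (h.A _ ?_) le_rfl
      rwa [Finset.sum_add_distrib]
    · refine S.prod hr.pos b (fun v => 0) (fun v => b (Sum.inl v)) 1 0 1
        (fun v => by simp) ?_ (S.zero _) le_rfl
      rw [mul_one]
      apply hC
      have h1 : ∑ v, b (Sum.inl v) ≤
          r * ∑ v, b (Sum.inl v) / r + (r - 1) * ∑ v, min (b (Sum.inl v) % r) 1 := by
        rw [Finset.mul_sum, Finset.mul_sum, ← Finset.sum_add_distrib]
        refine Finset.sum_le_sum fun v _ => ?_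
        have e1 := Nat.div_add_mod (b (Sum.inl v)) r
        have e2 := Nat.mod_lt (b (Sum.inl v)) hr.pos
        rcases Nat.eq_zero_or_pos (b (Sum.inl v) % r) with e | e
        · rw [e]; simp; omega
        · rw [min_eq_right e]; omega
      have h2 := hr.two_le
      obtain ⟨r', rfl⟩ : ∃ r', r = r' + 1 := ⟨r - 1, by omega⟩
      simp only [Nat.add_sub_cancel] at h1
      push Not at hc
      generalize ∑ v, b (Sum.inr v) = a at *
      generalize ∑ v, b (Sum.inl v) / (r' + 1) = T at *
      generalize ∑ v, min (b (Sum.inl v) % (r' + 1)) 1 = s at *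
      generalize ∑ v, b (Sum.inl v) = B at *
      have h3 : a < s := by
        by_contra hcon
        push Not at hcon
        have : r' * s ≤ r' * a := Nat.mul_le_mul_left _ hcon
        have : (r' + 1) * (a + T + 1) ≤ (r' + 1) * N := Nat.mul_le_mul_left _ hc
        nlinarith
      omega

theorem sub_sum (b t : V → ℕ) (r : ℕ) (h : ∀ v, r * t v ≤ b v) :
    ∑ v, (b v - r * t v) + r * ∑ v, t v = ∑ v, b v := by
  rw [Finset.mul_sum, ← Finset.sum_add_distrib]
  exact Finset.sum_congr rfl fun v _ => Nat.sub_add_cancel (h v)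

theorem Good1.stepC (h : Good1 w N) {r : ℕ} (hr3 : 3 ≤ r) (k : ℕ) (hk : 3 ≤ k)
    (b : V ⊕ V → ℕ) (hb : k * (r * N) < ∑ v, b v + ∑ v, min (b v) 1) :
    S (Sum.elim w (fun v => r * w v)) (r * N) b k := by
  have hr : 0 < r := by omega
  rw [Fintype.sum_sum_type, Fintype.sum_sum_type] at hb
  have hs1 := occ_le_sum (fun v => b (Sum.inr v))
  have hs1' := (occ_le_card (fun v => b (Sum.inr v))).trans h.card
  have hs0' := (occ_le_card (fun v => b (Sum.inl v))).trans h.card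
  have hN := h.pos
  by_cases c1 : k * N ≤ ∑ v, b (Sum.inr v)
  · exact S.prod hr b (fun _ => 0) (fun _ => 0) 0 k k (fun v => by simp) (S.zero _)
      (A_k h.A k _ (by simpa using c1)) (by simp)
  by_cases c2 : N ≤ ∑ v, b (Sum.inr v)
  · have e1 := Nat.div_add_mod (∑ v, b (Sum.inr v)) N
    have e2 := Nat.mod_lt (∑ v, b (Sum.inr v)) hN
    have e3 := Nat.div_pos c2 hN
    set j := (∑ v, b (Sum.inr v)) / N with hj
    have hjk : j < k := by
      rw [hj]; apply Nat.div_lt_of_lt_mul; rw [mul_comm]; omega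
    obtain ⟨i, rfl⟩ : ∃ i, k = j + i := ⟨k - j, by omega⟩
    refine S.prod hr b (fun _ => 0) (fun v => b (Sum.inl v)) i j _ (fun v => by simp)
      (h.C _ (by nlinarith) _ ?_)
      (A_k h.A j _ (by simp only [add_zero]; rw [mul_comm]; omega)) (by omega)
    have : N * 1 ≤ N * j := Nat.mul_le_mul_left _ e3
    have : 3 * (N * j) ≤ r * (N * j) := Nat.mul_le_mul_right _ hr3
    have e : (j + i) * (r * N) = r * (N * j) + r * i * N := by ring
    omega
  · push Not at c1 c2
    generalize ha : ∑ v, b (Sum.inr v) = a at *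
    have h1 : ∑ v, b (Sum.inl v) ≤
        r * ∑ v, (b (Sum.inl v) - 1) / r + r * ∑ v, min (b (Sum.inl v)) 1 := by
      rw [Finset.mul_sum, Finset.mul_sum, ← Finset.sum_add_distrib]
      refine Finset.sum_le_sum fun v _ => ?_
      have e1 := Nat.div_add_mod (b (Sum.inl v) - 1) r
      have e2 := Nat.mod_lt (b (Sum.inl v) - 1) hr
      rcases Nat.eq_zero_or_pos (b (Sum.inl v)) with e | e
      · rw [e]; simp
      · rw [min_eq_right e]; omega
    have h2 : N - a ≤ ∑ v, (b (Sum.inl v) - 1) / r := by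
      by_contra hcon
      push Not at hcon
      generalize ∑ v, (b (Sum.inl v) - 1) / r = T at *
      have : r * (T + a + 1) ≤ r * N := Nat.mul_le_mul_left _ (by omega)
      have : r * ∑ v, min (b (Sum.inl v)) 1 ≤ r * N := Nat.mul_le_mul_left _ hs0'
      have : 3 * (r * N) ≤ k * (r * N) := Nat.mul_le_mul_right _ hk
      have : 3 * N ≤ r * N := Nat.mul_le_mul_right _ hr3
      have : 3 * a ≤ r * a := Nat.mul_le_mul_right _ hr3
      have e : r * (T + a + 1) = r * T + r * a + r := by ring
      omega
    obtain ⟨t, ht1, ht2⟩ := exists_sub _ _ h2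
    have ht3 : ∀ v, r * t v ≤ b (Sum.inl v) - 1 := fun v =>
      (Nat.mul_le_mul_left r (ht1 v)).trans (Nat.mul_div_le _ _)
    have ht4 : ∀ v, r * t v ≤ b (Sum.inl v) := fun v => (ht3 v).trans (Nat.sub_le _ _)
    obtain ⟨i, rfl⟩ : ∃ i, k = i + 1 := ⟨k - 1, by omega⟩
    refine S.prod hr b t (fun v => b (Sum.inl v) - r * t v) i 1 _
      (fun v => by have := ht4 v; omega) (h.C _ (by nlinarith) _ ?_) (h.A _ ?_) le_rfl
    · have e1 := sub_sum _ _ _ ht4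
      have e2 : ∑ v, min (b (Sum.inl v) - r * t v) 1 = ∑ v, min (b (Sum.inl v)) 1 := by
        refine Finset.sum_congr rfl fun v _ => ?_
        have := ht3 v
        omega
      rw [e2]
      rw [ht2] at e1
      have e3 : r * (N - a) + r * a = r * N := by rw [← mul_add]; congr 1; omega
      have : 3 * a ≤ r * a := Nat.mul_le_mul_right _ hr3
      have e : (i + 1) * (r * N) = r * i * N + r * N := by ring
      omega
    · rw [Finset.sum_add_distrib, ha, ht2]; omega

theorem Good1.stepD (h : Good1 w N) {r : ℕ} (hr3 : 3 ≤ r) (hodd : r % 2 = 1)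
    (b : V ⊕ V → ℕ) (hb : 2 * (r * N) < ∑ v, b v + ∑ v, b v % 2) :
    S (Sum.elim w (fun v => r * w v)) (r * N) b 2 := by
  have hr : 0 < r := by omega
  rw [Fintype.sum_sum_type, Fintype.sum_sum_type] at hb
  have hs1 := (odd_le_occ _).trans (occ_le_sum (fun v => b (Sum.inr v)))
  have hs0 := odd_le_occ (fun v => b (Sum.inl v))
  have hcard := h.card
  have hN := h.pos
  by_cases c1 : 2 * N < ∑ v, b (Sum.inr v) + ∑ v, b (Sum.inr v) % 2
  · exact S.prod hr b (fun _ => 0) (fun _ => 0) 0 2 2 (fun v => by simp) (S.zero _)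
      (h.D _ (by simpa using c1)) (by simp)
  have hrN : 3 * N ≤ r * N := Nat.mul_le_mul_right _ hr3
  by_cases c2 : N ≤ ∑ v, b (Sum.inr v)
  · refine S.prod hr b (fun _ => 0) (fun v => b (Sum.inl v)) 1 1 _ (fun v => by simp)
      (h.C _ (by omega) _ ?_) (h.A _ (by simpa using c2)) (by omega)
    rw [mul_one]
    omega
  push Not at c1 c2
  generalize ha : ∑ v, b (Sum.inr v) = a at *
  set T : V → ℕ := fun v => (b (Sum.inl v) - b (Sum.inl v) % 2) / r with hT
  have hra : 3 * a ≤ r * a := Nat.mul_le_mul_right _ hr3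
  by_cases c3 : N - a ≤ ∑ v, T v
  · obtain ⟨t, ht1, ht2⟩ := exists_sub _ _ c3
    have ht3 : ∀ v, r * t v ≤ b (Sum.inl v) - b (Sum.inl v) % 2 := fun v =>
      (Nat.mul_le_mul_left r (ht1 v)).trans (Nat.mul_div_le _ _)
    have ht4 : ∀ v, r * t v ≤ b (Sum.inl v) := fun v => (ht3 v).trans (Nat.sub_le _ _)
    refine S.prod hr b t (fun v => b (Sum.inl v) - r * t v) 1 1 _
      (fun v => by have := ht4 v; omega) (h.C _ (by omega) _ ?_) (h.A _ ?_) le_rfl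
    · have e1 := sub_sum _ _ _ ht4
      have e2 : ∑ v, b (Sum.inl v) % 2 ≤ ∑ v, min (b (Sum.inl v) - r * t v) 1 := by
        refine Finset.sum_le_sum fun v _ => ?_
        have := ht3 v
        omega
      rw [ht2] at e1
      have e3 : r * (N - a) + r * a = r * N := by rw [← mul_add]; congr 1; omega
      rw [mul_one]
      omega
    · rw [Finset.sum_add_distrib, ha, ht2]; omega
  · push Not at c3
    refine S.prod hr b (fun v => b (Sum.inl v) / r) (fun _ => 0) 0 2 2
        (fun v => by simpa using Nat.mul_div_le _ _) (S.zero _) (h.D _ ?_) le_rfl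
    rw [Finset.sum_add_distrib, ha]
    obtain ⟨r', rfl⟩ : ∃ r', r = r' + 1 := ⟨r - 1, by omega⟩
    have e1 : ∑ v, b (Sum.inl v) + ∑ v, b (Sum.inl v) % 2 ≤
        r' * ∑ v, T v + r' * Fintype.card V + ∑ v, b (Sum.inl v) / (r' + 1)
          + ∑ v, (b (Sum.inl v) / (r' + 1)) % 2 := by
      have : r' * Fintype.card V = ∑ v : V, r' := by simp [mul_comm]
      rw [this, Finset.mul_sum]
      simp only [← Finset.sum_add_distrib]
      refine Finset.sum_le_sum fun v _ => ?_
      simp only [hT]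
      generalize b (Sum.inl v) = x
      have d1 := Nat.div_add_mod x (r' + 1)
      have d2 := Nat.mod_lt x hr
      have p1 : x % 2 = ((r' + 1) * (x / (r' + 1)) + x % (r' + 1)) % 2 := by rw [d1]
      rw [Nat.add_mod, Nat.mul_mod, hodd, one_mul, Nat.mod_mod] at p1
      rcases Nat.mod_two_eq_zero_or_one x with hx | hx
      · rw [hx, Nat.sub_zero]
        generalize x / (r' + 1) = y at *
        have : (r' + 1) * y = r' * y + y := by ring
        omega
      · rw [hx]
        rcases Nat.eq_zero_or_pos (x % (r' + 1)) with e | e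
        · have hy : 0 < x / (r' + 1) := by
            rcases Nat.eq_zero_or_pos (x / (r' + 1)) with e' | e'
            · rw [e, e'] at d1; omega
            · exact e'
          have f1 : (x - 1) / (r' + 1) = x / (r' + 1) - 1 := by
            obtain ⟨z, hz⟩ : ∃ z, x / (r' + 1) = z + 1 := ⟨x / (r' + 1) - 1, by omega⟩
            rw [hz] at d1 ⊢
            have : x - 1 = r' + (r' + 1) * z := by
              have : (r' + 1) * (z + 1) = (r' + 1) * z + r' + 1 := by ring
              omega
            rw [this, Nat.add_mul_div_left _ _ hr, Nat.div_eq_of_lt (by omega)]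
            omega
          rw [f1]
          obtain ⟨z, hz⟩ : ∃ z, x / (r' + 1) = z + 1 := ⟨x / (r' + 1) - 1, by omega⟩
          rw [hz] at d1 p1 ⊢
          have : (r' + 1) * (z + 1) = r' * z + r' + z + 1 := by ring
          simp only [Nat.add_sub_cancel]
          omega
        · have f1 : (x - 1) / (r' + 1) = x / (r' + 1) := by
            have : x - 1 = (x % (r' + 1) - 1) + (r' + 1) * (x / (r' + 1)) := by omega
            conv_lhs => rw [this]
            rw [Nat.add_mul_div_left _ _ hr, Nat.div_eq_of_lt (by omega)]
            omega
          rw [f1]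
          generalize x / (r' + 1) = y at *
          have : (r' + 1) * y = r' * y + y := by ring
          omega
    have e2 : ∑ v, (b (Sum.inl v) / (r' + 1)) % 2 ≤
        ∑ v, (b (Sum.inr v) + b (Sum.inl v) / (r' + 1)) % 2 + ∑ v, b (Sum.inr v) % 2 := by
      rw [← Finset.sum_add_distrib]
      refine Finset.sum_le_sum fun v _ => ?_
      omega
    have e3 : r' * Fintype.card V ≤ r' * N := Nat.mul_le_mul_left _ hcard
    have e4 : r' * (∑ v, T v + a + 1) ≤ r' * N := Nat.mul_le_mul_left _ (by omega)
    have e5 : 2 * (a + 1) ≤ r' * (a + 1) := Nat.mul_le_mul_right _ (by omega)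
    generalize ∑ v, T v = TT at *
    have e6 : r' * (TT + a + 1) = r' * TT + r' * (a + 1) := by ring
    have e7 : (r' + 1) * N = r' * N + N := by ring
    omega

theorem Good1.step (h : Good1 w N) {r : ℕ} (hr : r.Prime) (hr3 : 3 ≤ r) :
    Good1 (Sum.elim w (fun v => r * w v)) (r * N) where
  toBase := h.toBase.step hr (by
    intro b hb
    refine h.C r hr3 b (hb.trans_le ?_)
    gcongr
    exact Nat.mod_le _ _)
  C := fun k hk b hb => h.stepC hr3 k hk b hb
  D := fun b hb => h.stepD hr3 (hr.eq_two_or_odd.resolve_left (by omega)) b hb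

theorem Good2.stepD (h : Good2 w N) (k : ℕ) (hk : 2 ≤ k)
    (b : V ⊕ V → ℕ) (hb : k * (2 * N) < ∑ v, b v + ∑ v, b v % 2) :
    S (Sum.elim w (fun v => 2 * w v)) (2 * N) b k := by
  have hr : 0 < 2 := by omega
  rw [Fintype.sum_sum_type, Fintype.sum_sum_type] at hb
  have hs1 := (odd_le_occ _).trans (occ_le_sum (fun v => b (Sum.inr v)))
  have hs1' := ((odd_le_occ _).trans (occ_le_card (fun v => b (Sum.inr v)))).trans h.card
  have hs0' := ((odd_le_occ _).trans (occ_le_card (fun v => b (Sum.inl v)))).trans h.card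
  have hN := h.pos
  by_cases c0 : k * N < ∑ v, b (Sum.inr v) + ∑ v, b (Sum.inr v) % 2
  · exact S.prod hr b (fun _ => 0) (fun _ => 0) 0 k k (fun v => by simp) (S.zero _)
      (h.D k hk _ (by simpa using c0)) (by simp)
  by_cases c1 : k * N ≤ ∑ v, b (Sum.inr v)
  · exact S.prod hr b (fun _ => 0) (fun _ => 0) 0 k k (fun v => by simp) (S.zero _)
      (A_k h.A k _ (by simpa using c1)) (by simp)
  -- a general way to finish
  have key : ∀ j i, k = j + i → 1 ≤ i →
      ∑ v, b (Sum.inr v) + ∑ v, b (Sum.inr v) % 2 ≤ 2 * (N * j) →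
      S w N (fun v => b (Sum.inr v)) j → S (Sum.elim w (fun v => 2 * w v)) (2 * N) b k := by
    intro j i hji hi hle hS
    subst hji
    refine S.prod hr b (fun _ => 0) (fun v => b (Sum.inl v)) i j _ (fun v => by simp)
      (h.D _ (by omega) _ ?_) hS (by omega)
    have e : (j + i) * (2 * N) = 2 * (N * j) + 2 * i * N := by ring
    omega
  by_cases c2 : 2 * N ≤ ∑ v, b (Sum.inr v)
  · have e1 := Nat.div_add_mod (∑ v, b (Sum.inr v)) N
    have e2 := Nat.mod_lt (∑ v, b (Sum.inr v)) hN
    have e3 : 2 ≤ (∑ v, b (Sum.inr v)) / N := (Nat.le_div_iff_mul_le hN).2 c2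
    set j := (∑ v, b (Sum.inr v)) / N with hj
    have hjk : j < k := by
      rw [hj]; apply Nat.div_lt_of_lt_mul; rw [mul_comm]; omega
    have : N * 2 ≤ N * j := Nat.mul_le_mul_left _ e3
    exact key j (k - j) (by omega) (by omega) (by omega)
      (A_k h.A j _ (by rw [mul_comm]; omega))
  by_cases c3 : N ≤ ∑ v, b (Sum.inr v)
  · by_cases c4 : ∑ v, b (Sum.inr v) + ∑ v, b (Sum.inr v) % 2 ≤ 2 * N
    · exact key 1 (k - 1) (by omega) (by omega) (by omega) (h.A _ c3)
    · have : k ≠ 2 := by rintro rfl; omega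
      exact key 2 (k - 2) (by omega) (by omega) (by omega) (h.D 2 le_rfl _ (by omega))
  push Not at c3
  generalize ha : ∑ v, b (Sum.inr v) = a at *
  have h1 : ∑ v, b (Sum.inl v) = 2 * ∑ v, b (Sum.inl v) / 2 + ∑ v, b (Sum.inl v) % 2 := by
    rw [Finset.mul_sum, ← Finset.sum_add_distrib]
    exact Finset.sum_congr rfl fun v _ => by omega
  have h2 : N - a ≤ ∑ v, b (Sum.inl v) / 2 := by
    have : 2 * (2 * N) ≤ k * (2 * N) := Nat.mul_le_mul_right _ hk
    omega
  obtain ⟨t, ht1, ht2⟩ := exists_sub _ _ h2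
  have ht4 : ∀ v, 2 * t v ≤ b (Sum.inl v) := fun v => by have := ht1 v; omega
  obtain ⟨i, rfl⟩ : ∃ i, k = i + 1 := ⟨k - 1, by omega⟩
  refine S.prod hr b t (fun v => b (Sum.inl v) - 2 * t v) i 1 _
    (fun v => by have := ht4 v; omega) (h.D _ (by omega) _ ?_) (h.A _ ?_) le_rfl
  · have e1 := sub_sum _ _ _ ht4
    have e2 : ∑ v, (b (Sum.inl v) - 2 * t v) % 2 = ∑ v, b (Sum.inl v) % 2 := by
      refine Finset.sum_congr rfl fun v _ => ?_
      have := ht4 v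
      omega
    rw [e2]
    have e : (i + 1) * (2 * N) = 2 * i * N + 2 * N := by ring
    omega
  · rw [Finset.sum_add_distrib, ha, ht2]; omega

theorem Good2.step (h : Good2 w N) : Good2 (Sum.elim w (fun v => 2 * w v)) (2 * N) where
  toBase := h.toBase.step Nat.prime_two (by
    intro b hb
    refine h.D 2 le_rfl b (hb.trans_le ?_)
    gcongr
    exact min_le_left _ _)
  D := fun k hk b hb => h.stepD k hk b hb

end

theorem good1_base : Good1 (fun _ : Unit => 1) 1 := by
  have key : ∀ (b : Unit → ℕ) k, k ≤ b () → S (fun _ : Unit => 1) 1 b k := by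
    intro b k hk g
    simpa using Reach.of_le ((Multiset.replicate_le_replicate _).2 hk)
  refine ⟨⟨by simp, by simp, by simp, ?_⟩, ?_, ?_⟩
  · intro b hb; exact key b 1 (by simpa using hb)
  · intro k hk b hb
    simp at hb
    exact key b k (by change _ ≤ b PUnit.unit; omega)
  · intro b hb
    simp at hb
    exact key b 2 (by change _ ≤ b PUnit.unit; omega)

theorem exists_good1 (m : ℕ) (hm : m % 2 = 1) :
    ∃ (V : Type) (_ : Fintype V) (w : V → ℕ), Good1 w m := by
  induction m using Nat.strong_induction_on with
  | _ m ih =>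
    by_cases h1 : m = 1
    · subst h1; exact ⟨Unit, inferInstance, _, good1_base⟩
    · have hp := Nat.minFac_prime h1
      obtain ⟨m', hm'⟩ := Nat.minFac_dvd m
      set p := m.minFac
      have hpm : p % 2 = 1 ∧ m' % 2 = 1 := by
        rw [hm'] at hm
        exact Nat.odd_mul.1 (Nat.odd_iff.2 hm) |>.imp Nat.odd_iff.1 Nat.odd_iff.1
      have hp2 := hp.two_le
      obtain ⟨V, _, w, hw⟩ := ih m' (by have : 0 < m' := by omega
                                        nlinarith) hpm.2
      rw [hm']
      exact ⟨V ⊕ V, inferInstance, _, hw.step hp (by omega)⟩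

theorem exists_good2 (q : ℕ) (hq : 0 < q) :
    ∃ (V : Type) (_ : Fintype V) (w : V → ℕ), Good2 w q := by
  induction q using Nat.strong_induction_on with
  | _ q ih =>
    rcases Nat.mod_two_eq_zero_or_one q with h | h
    · obtain ⟨V, _, w, hw⟩ := ih (q / 2) (by omega) (by omega)
      have : q = 2 * (q / 2) := by omega
      rw [this]
      exact ⟨V ⊕ V, inferInstance, _, hw.step⟩
    · obtain ⟨V, i, w, hw⟩ := exists_good1 q h
      exact ⟨V, i, w, hw.toGood2⟩

theorem reach_top (q : ℕ) (hq : 0 < q) (f : Fin q → ℕ) (hf : ∀ i, f i ∣ q) :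
    Reach (Finset.univ.val.map f) {q} := by
  classical
  obtain ⟨V, _, w, hw⟩ := exists_good2 q hq
  choose p hp using fun i => hw.cover (f i) (hf i)
  have hs : ∑ v, (Finset.univ.filter (fun i => p i = v)).card = q := by
    have := Finset.card_eq_sum_card_fiberwise (f := p) (s := Finset.univ) (t := Finset.univ)
      (by simp)
    simpa using this.symm
  have := hw.A (fun v => (Finset.univ.filter (fun i => p i = v)).card) hs.ge 1
  simp only [one_mul, Multiset.replicate_one] at this
  convert this using 1
  have e : Finset.univ.val.map f = ∑ i, ({f i} : Multiset ℕ) := by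
    exact (Multiset.sum_map_singleton (Finset.univ.val.map f)).symm.trans (by rw [Multiset.map_map]; rfl)
  rw [e, ← Finset.sum_fiberwise (s := Finset.univ) (g := p)]
  refine Finset.sum_congr rfl fun v _ => ?_
  rw [Finset.sum_congr rfl (g := fun _ => ({w v} : Multiset ℕ))]
  · rw [Finset.sum_const, Multiset.nsmul_singleton]
  · intro i hi
    rw [← hp i, (Finset.mem_filter.1 hi).2]

/-- pigeonhole -/
theorem zero_sum {α : Type} (r : ℕ) (hr : 0 < r) (P : Multiset α) (hP : P.card = r) (x : α → ℕ) :
    ∃ Q ≤ P, Q ≠ 0 ∧ r ∣ (Q.map x).sum := by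
  induction P using Quotient.inductionOn with
  | _ l =>
    have hl : l.length = r := by simpa using hP
    obtain ⟨i, hi, j, hj, hij, h⟩ := Finset.exists_ne_map_eq_of_card_lt_of_maps_to
      (s := Finset.range (r + 1)) (t := Finset.range r)
      (f := fun i => ((l.take i).map x).sum % r) (by simp)
      (by intro i _; simpa using Nat.mod_lt _ hr)
    wlog hlt : i < j generalizing i j
    · exact this j hj i hi hij.symm h.symm (by omega)
    simp only [Finset.mem_range] at hi hj
    refine ⟨((l.take j).drop i : List α), ?_, ?_, ?_⟩
    · exact Multiset.coe_le.2 (((List.drop_sublist _ _).trans (List.take_sublist _ _)).subperm)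
    · intro h0
      have := congrArg Multiset.card h0
      simp at this
      omega
    · have e : l.take j = l.take i ++ (l.take j).drop i := by
        conv_lhs => rw [← List.take_append_drop i (l.take j)]
        rw [List.take_take, min_eq_left hlt.le]
      have e2 : ((l.take j).map x).sum = ((l.take i).map x).sum
          + (((l.take j).drop i).map x).sum := by
        conv_lhs => rw [e]
        simp
      have h' : ((l.take i).map x).sum ≡ ((l.take j).map x).sum [MOD r] := h
      have := (Nat.modEq_iff_dvd' (by omega)).1 h'
      rw [e2, Nat.add_sub_cancel_left] at this
      simpa using this

section
variable {ι : Type} (n c : ι → ℕ)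

def ok (A : Multiset ι) (g : ℕ) : Prop := A ≠ 0 ∧ g ∣ (A.map n).sum ∧ (A.map c).sum ≤ g

theorem rel_rep {r g : ℕ} {P : Multiset (Multiset ι)}
    (h : Multiset.Rel (ok n c) P (Multiset.replicate r g)) :
    P.card = r ∧ ∀ A ∈ P, ok n c A g := by
  refine ⟨by simpa using Multiset.card_eq_card_of_rel h, fun A hA => ?_⟩
  obtain ⟨x, hx, hx'⟩ := Multiset.exists_mem_of_rel_of_mem h hA
  rwa [Multiset.eq_of_mem_replicate hx] at hx'

theorem Reach.realize {M M' : Multiset ℕ} (h : Reach M M') :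
    ∀ P : Multiset (Multiset ι), Multiset.Rel (ok n c) P M →
      ∃ P' : Multiset (Multiset ι), P'.join ≤ P.join ∧ Multiset.Rel (ok n c) P' M' := by
  induction h with
  | refl M => intro P hP; exact ⟨P, le_rfl, hP⟩
  | trans M M' M'' _ _ ih1 ih2 =>
    intro P hP
    obtain ⟨P1, h1, h2⟩ := ih1 P hP
    obtain ⟨P2, h3, h4⟩ := ih2 P1 h2
    exact ⟨P2, h3.trans h1, h4⟩
  | add M M' K _ ih =>
    intro P hP
    obtain ⟨P0, P1, h0, h1, rfl⟩ := Multiset.rel_add_right.1 hP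
    obtain ⟨P2, h2, h3⟩ := ih P0 h0
    refine ⟨P2 + P1, ?_, h3.add h1⟩
    rw [Multiset.join_add, Multiset.join_add]
    gcongr
  | drop M => intro P _; exact ⟨0, by simp, Multiset.Rel.zero⟩
  | merge r g hr =>
    intro P hP
    obtain ⟨hc, hall⟩ := (rel_rep n c) hP
    obtain ⟨Q, hQ, hQ0, hdvd⟩ := zero_sum r hr P hc (fun A => (A.map n).sum / g)
    have hQall : ∀ A ∈ Q, ok n c A g := fun A hA => hall A (Multiset.mem_of_le hQ hA)
    have hj : Q.join ≤ P.join := by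
      obtain ⟨R, rfl⟩ := Multiset.le_iff_exists_add.1 hQ
      rw [Multiset.join_add]; exact Multiset.le_add_right _ _
    refine ⟨{Q.join}, by simpa using hj, ?_⟩
    have hrel : ok n c Q.join (g * r) := by
      refine ⟨?_, ?_, ?_⟩
      · obtain ⟨A, hA⟩ := Multiset.exists_mem_of_ne_zero hQ0
        obtain ⟨a, ha⟩ := Multiset.exists_mem_of_ne_zero (hQall A hA).1
        intro h0
        have : a ∈ Q.join := Multiset.mem_join.2 ⟨A, hA, ha⟩
        simp [h0] at this
      · rw [Multiset.map_join, Multiset.sum_join, Multiset.map_map]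
        have : Q.map (Multiset.sum ∘ Multiset.map n) =
            Q.map (fun A => g * ((A.map n).sum / g)) :=
          Multiset.map_congr rfl fun A hA => (Nat.mul_div_cancel' (hQall A hA).2.1).symm
        rw [this, Multiset.sum_map_mul_left]
        exact Nat.mul_dvd_mul_left _ hdvd
      · rw [Multiset.map_join, Multiset.sum_join, Multiset.map_map]
        have h1 : (Q.map (Multiset.sum ∘ Multiset.map c)).sum ≤ (Q.map (fun _ => g)).sum :=
          Multiset.sum_map_le_sum_map _ _ fun A hA => (hQall A hA).2.2
        rw [Multiset.map_const', Multiset.sum_replicate, smul_eq_mul] at h1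
        have h2 := Multiset.card_le_card hQ
        rw [hc] at h2
        exact h1.trans (by rw [mul_comm]; exact Nat.mul_le_mul_left _ h2)
    exact Multiset.Rel.cons hrel Multiset.Rel.zero

end

theorem kleitman_lemke (q : ℕ) (hq : 0 < q) (n : Fin q → ℕ) :
    ∃ I : Finset (Fin q), I.Nonempty ∧ q ∣ ∑ i ∈ I, n i ∧ ∑ i ∈ I, Nat.gcd q (n i) ≤ q := by
  have h := reach_top q hq (fun i => Nat.gcd q (n i)) (fun i => Nat.gcd_dvd_left _ _)
  obtain ⟨P, hP, hrel⟩ := h.realize n (fun i => Nat.gcd q (n i))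
    (Finset.univ.val.map fun i => {i}) (by
      rw [Multiset.rel_map]
      refine Multiset.rel_refl_of_refl_on fun i _ => ?_
      exact ⟨by simp, by simpa using Nat.gcd_dvd_right _ _, by simp⟩)
  rw [← Multiset.cons_zero, Multiset.rel_cons_right] at hrel
  obtain ⟨A, P', hA, hP', rfl⟩ := hrel
  rw [Multiset.rel_zero_right] at hP'
  subst hP'
  have hle : A ≤ Finset.univ.val := by
    refine le_trans (by simp) (hP.trans (le_of_eq ?_))
    change Multiset.bind _ _ = _
    rw [Multiset.bind_singleton, Multiset.map_id']
  have hnd : A.Nodup := Multiset.nodup_of_le hle Finset.univ.nodup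
  refine ⟨⟨A, hnd⟩, ?_, hA.2.1, hA.2.2⟩
  obtain ⟨a, ha⟩ := Multiset.exists_mem_of_ne_zero hA.1
  exact ⟨a, ha⟩

end EL

theorem erdos_lemke (q : ℕ) (hq : 0 < q) (n : Fin q → ℕ) (hn : ∀ i, 0 < n i) :
    ∃ I : Finset (Fin q), I.Nonempty ∧ (q : ℕ) ∣ ∑ i ∈ I, n i ∧
      ∑ i ∈ I, n i ≤ Nat.lcm q (Finset.univ.lcm fun i => n i) := by
  obtain ⟨I, h1, h2, h3⟩ := EL.kleitman_lemke q hq n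
  refine ⟨I, h1, h2, ?_⟩
  set L := Nat.lcm q (Finset.univ.lcm fun i => n i) with hL
  have hLpos : 0 < L := by
    apply Nat.lcm_pos hq
    apply Nat.pos_of_ne_zero
    intro h0
    rw [Finset.lcm_eq_zero_iff] at h0
    obtain ⟨i, _, hi⟩ := h0
    exact (hn i).ne' hi
  refine Nat.le_of_mul_le_mul_left ?_ hq
  calc q * ∑ i ∈ I, n i = ∑ i ∈ I, Nat.gcd q (n i) * Nat.lcm q (n i) := by
        rw [Finset.mul_sum]
        exact Finset.sum_congr rfl fun i _ => (Nat.gcd_mul_lcm _ _).symm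
    _ ≤ ∑ i ∈ I, Nat.gcd q (n i) * L := by
        refine Finset.sum_le_sum fun i _ => Nat.mul_le_mul_left _ (Nat.le_of_dvd hLpos ?_)
        exact Nat.lcm_dvd (Nat.dvd_lcm_left _ _)
          ((Finset.dvd_lcm (Finset.mem_univ i)).trans (Nat.dvd_lcm_right _ _))
    _ = (∑ i ∈ I, Nat.gcd q (n i)) * L := by rw [Finset.sum_mul]
    _ ≤ q * L := Nat.mul_le_mul_right _ h3
end
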